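/- arXiv:2009.00899 — 4 statements merged into one kernel-verified Lean document; each statement's English description precedes it below -/
import Mathlib

section
/- Let T>0, let (Ω,F,P,(F_t)_{t∈[0,T]}) be a complete filtered probability space satisfying the usual conditions, let θ∈(0,1), α:=(1−θ)/2, and let L=(L_t)_{t∈[0,T)} be a càdlàg martingale with L_t∈L_2 for every t∈[0,T). Then the following assertions are equivalent: (i) the martingale (I_t^α L)_{t∈[0,T)} is bounded in L_2, i.e. sup_{t∈[0,T)} E|I_t^α L|² < ∞ (equivalently, it converges in L_2 as t↑T); (ii) there is a c>0 such that E[L;τ]_T ≤ c‖τ‖_θ for all deterministic time nets τ∈𝒯; (iii) ∫_0^T (T−t)^{−θ} E[L_t²] dt < ∞. -/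
open MeasureTheory Filter Set ENNReal

/-- A function `K : ℝ → ℝ` is càdlàg on `[0,T)`. -/
def CadlagOn (K : ℝ → ℝ) (T : ℝ) : Prop :=
  (∀ t ∈ Set.Ico (0:ℝ) T, Filter.Tendsto K (nhdsWithin t (Set.Ici t)) (nhds (K t))) ∧
  (∀ t ∈ Set.Ioo (0:ℝ) T, ∃ l : ℝ, Filter.Tendsto K (nhdsWithin t (Set.Iio t)) (nhds l))

/-- The Riemann–Liouville type operator
`I_t^α K := (α/T^α) ∫_0^t (T−u)^{α−1} K_u du + ((T−t)/T)^α K_t`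
(`= (α/T^α) ∫_0^T (T−u)^{α−1} K_{u∧t} du` for `α > 0`). -/
noncomputable def rl (T α : ℝ) (K : ℝ → ℝ) (t : ℝ) : ℝ :=
  (α / T ^ α) * (∫ u in (0:ℝ)..t, (T - u) ^ (α - 1) * K u) + ((T - t) / T) ^ α * K t

/-- A deterministic time net `0 = t_0 < t_1 < ⋯ < t_n = T` with `n ≥ 1`. -/
def IsTimeNet (T : ℝ) (n : ℕ) (t : ℕ → ℝ) : Prop :=
  1 ≤ n ∧ t 0 = 0 ∧ t n = T ∧ ∀ i < n, t i < t (i + 1)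

/-- The mesh size `‖τ‖_θ = max_{1≤i≤n} (t_i − t_{i−1})/(T − t_{i−1})^{1−θ}`. -/
noncomputable def meshTheta (T θ : ℝ) (n : ℕ) (t : ℕ → ℝ) : ℝ :=
  ⨆ i ∈ Finset.range n, (t (i + 1) - t i) / (T - t i) ^ (1 - θ)

/-- The expectation `E [L;τ]_T` of the square function
`[L;τ]_T = ∫_0^T |L_u − Σ_i L_{t_{i−1}} 1_{(t_{i−1},t_i]}(u)|² du`, in the extended sense. -/
noncomputable def sqFnE {Ω : Type*} [MeasurableSpace Ω] (μ : Measure Ω)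
    (L : ℝ → Ω → ℝ) (n : ℕ) (t : ℕ → ℝ) : ℝ≥0∞ :=
  ∫⁻ ω, (∑ i ∈ Finset.range n,
    ∫⁻ u in Set.Ioc (t i) (t (i + 1)), ENNReal.ofReal ((L u ω - L (t i) ω) ^ 2)) ∂μ

/-- The measure on `(0,T)` with density `a T^{-a} (T-u)^{a-1}`. -/
noncomputable def nuM (T a : ℝ) : Measure ℝ :=
  (volume.restrict (Set.Ioo 0 T)).withDensity
    (fun u => ENNReal.ofReal (a / T ^ a * (T - u) ^ (a - 1)))

lemma measurable_dens (T a : ℝ) :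
    Measurable (fun u : ℝ => ENNReal.ofReal (a / T ^ a * (T - u) ^ (a - 1))) := by
  fun_prop

lemma integral_dens {T a w : ℝ} (hT : 0 < T) (ha : 0 < a) (hw : w ≤ T) :
    IntegrableOn (fun u : ℝ => a / T ^ a * (T - u) ^ (a - 1)) (Set.Ioo w T) ∧
    ∫ u in Set.Ioo w T, a / T ^ a * (T - u) ^ (a - 1) = ((T - w) / T) ^ a := by
  have h1 : IntervalIntegrable (fun x : ℝ => x ^ (a - 1)) volume 0 (T - w) :=
    intervalIntegral.intervalIntegrable_rpow' (by linarith)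
  have h2 := (h1.comp_sub_left T)
  rw [sub_zero, _root_.sub_sub_cancel] at h2
  have h3 := (h2.symm.const_mul (a / T ^ a))
  constructor
  · rw [intervalIntegrable_iff_integrableOn_Ioo_of_le hw] at h3
    exact h3
  · rw [← integral_Ioc_eq_integral_Ioo, ← intervalIntegral.integral_of_le hw,
      intervalIntegral.integral_const_mul,
      intervalIntegral.integral_comp_sub_left (fun x : ℝ => x ^ (a - 1)) T,
      integral_rpow (Or.inl (by linarith))]
    simp only [sub_self, sub_add_cancel]
    rw [Real.zero_rpow ha.ne', Real.div_rpow (by linarith) hT.le]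
    field_simp
    ring

lemma nuM_Ioo {T a w : ℝ} (hT : 0 < T) (ha : 0 < a) (h0 : 0 ≤ w) (hw : w ≤ T) :
    nuM T a (Set.Ioo w T) = ENNReal.ofReal (((T - w) / T) ^ a) := by
  rw [nuM, withDensity_apply _ measurableSet_Ioo, Measure.restrict_restrict measurableSet_Ioo,
    Set.inter_eq_left.2 (Set.Ioo_subset_Ioo_left h0), ← (integral_dens hT ha hw).2,
    ofReal_integral_eq_lintegral_ofReal (integral_dens hT ha hw).1]
  refine (ae_restrict_iff' measurableSet_Ioo).2 (Filter.Eventually.of_forall fun u hu => ?_)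
  have : 0 < T - u := by linarith [hu.2]
  simp only [Pi.zero_apply]
  positivity

lemma nuM_ae {T a : ℝ} : ∀ᵐ u ∂(nuM T a), u ∈ Set.Ioo 0 T :=
  (withDensity_absolutelyContinuous _ _).ae_le (ae_restrict_mem measurableSet_Ioo)

lemma nuM_ac {T a : ℝ} : nuM T a ≪ volume :=
  (withDensity_absolutelyContinuous _ _).trans (Measure.absolutelyContinuous_of_le Measure.restrict_le_self)

lemma nuM_Ici {T a w : ℝ} (hT : 0 < T) (ha : 0 < a) :
    nuM T a (Set.Ici w) = ENNReal.ofReal (((T - min (max w 0) T) / T) ^ a) := by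
  rw [← nuM_Ioo hT ha (by positivity) (min_le_right _ _)]
  apply measure_congr
  have h0 : ∀ᵐ u ∂(nuM T a), u ≠ w := nuM_ac.ae_le (Measure.ae_ne volume w)
  filter_upwards [nuM_ae (T := T) (a := a), h0] with u hu h0
  apply propext
  change u ∈ Set.Ici w ↔ u ∈ Set.Ioo _ T
  simp only [Set.mem_Ici, Set.mem_Ioo, min_lt_iff, max_lt_iff]
  obtain ⟨h1, h2⟩ := hu
  constructor
  · intro h
    exact ⟨Or.inl ⟨lt_of_le_of_ne h (Ne.symm h0), h1⟩, h2⟩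
  · rintro ⟨h | h, -⟩
    · exact h.1.le
    · linarith

lemma nuM_prob {T a : ℝ} (hT : 0 < T) (ha : 0 < a) : IsProbabilityMeasure (nuM T a) := by
  constructor
  have : nuM T a Set.univ = nuM T a (Set.Ioo 0 T) := by
    apply measure_congr
    filter_upwards [nuM_ae (T := T) (a := a)] with u hu
    exact propext ⟨fun _ => hu, fun _ => trivial⟩
  rw [this, nuM_Ioo hT ha le_rfl hT.le]
  simp [hT.ne']

lemma nuM_map_min {T a : ℝ} (hT : 0 < T) (ha : 0 < a) :
    ((nuM T a).prod (nuM T a)).map (fun p : ℝ × ℝ => min p.1 p.2) = nuM T (2 * a) := by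
  have := nuM_prob hT ha
  have hm : Measurable (fun p : ℝ × ℝ => min p.1 p.2) := by fun_prop
  have := Measure.isProbabilityMeasure_map (μ := (nuM T a).prod (nuM T a)) hm.aemeasurable
  apply Measure.ext_of_Ici
  intro w
  rw [Measure.map_apply hm measurableSet_Ici]
  have : (fun p : ℝ × ℝ => min p.1 p.2) ⁻¹' Set.Ici w = Set.Ici w ×ˢ Set.Ici w := by
    ext p; simp [Prod.le_def]
  have hnn : 0 ≤ (T - min (max w 0) T) / T :=
    div_nonneg (by linarith [min_le_right (max w 0) T]) hT.le
  rw [this, Measure.prod_prod, nuM_Ici hT ha, nuM_Ici hT (by linarith),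
    ← ENNReal.ofReal_mul (by positivity), two_mul, Real.rpow_add_of_nonneg hnn ha.le ha.le]

lemma rl_eq {T a t : ℝ} (hT : 0 < T) (ha : 0 < a) (ht : t ∈ Set.Ico 0 T) (K : ℝ → ℝ)
    (hK : IntegrableOn K (Set.Ioc 0 t)) :
    rl T a K t = ∫ u, K (min u t) ∂(nuM T a) := by
  rw [nuM, integral_withDensity_eq_integral_toReal_smul (measurable_dens T a) (by simp)]
  have h1 : ∫ u in Set.Ioo 0 T, (ENNReal.ofReal (a / T ^ a * (T - u) ^ (a - 1))).toReal • K (min u t)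
      = ∫ u in Set.Ioo 0 T, (a / T ^ a * (T - u) ^ (a - 1)) * K (min u t) := by
    apply setIntegral_congr_fun measurableSet_Ioo
    intro u hu
    have : 0 < T - u := by linarith [hu.2]
    simp only [smul_eq_mul]
    rw [ENNReal.toReal_ofReal (by positivity)]
  have hU : Set.Ioo 0 T = Set.Ioc 0 t ∪ Set.Ioo t T := (Set.Ioc_union_Ioo_eq_Ioo ht.1 ht.2).symm
  have hA : Set.EqOn (fun u => (a / T ^ a * (T - u) ^ (a - 1)) * K (min u t))
      (fun u => (a / T ^ a) * ((T - u) ^ (a - 1) * K u)) (Set.Ioc 0 t) := by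
    intro u hu
    simp only [min_eq_left hu.2]
    ring
  have hB : Set.EqOn (fun u => (a / T ^ a * (T - u) ^ (a - 1)) * K (min u t))
      (fun u => (a / T ^ a * (T - u) ^ (a - 1)) * K t) (Set.Ioo t T) := by
    intro u hu
    simp only [min_eq_right hu.1.le]
  have hAi : IntegrableOn (fun u => (a / T ^ a) * ((T - u) ^ (a - 1) * K u)) (Set.Ioc 0 t) := by
    apply Integrable.const_mul
    have hc : ContinuousOn (fun u : ℝ => (T - u) ^ (a - 1)) (Set.Icc 0 t) := by
      apply ContinuousOn.rpow_const (by fun_prop)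
      intro u hu
      left
      linarith [hu.2, ht.2]
    rw [← integrableOn_Icc_iff_integrableOn_Ioc] at hK
    have := hK.continuousOn_mul hc isCompact_Icc
    exact this.mono_set Set.Ioc_subset_Icc_self
  have hBi : IntegrableOn (fun u => (a / T ^ a * (T - u) ^ (a - 1)) * K t) (Set.Ioo t T) :=
    (integral_dens hT ha ht.2.le).1.mul_const _
  rw [h1, hU, setIntegral_union (Set.disjoint_left.2 fun u h h' => by
      exact absurd h.2 (not_le.2 h'.1)) measurableSet_Ioo
      (hAi.congr_fun hA.symm measurableSet_Ioc) (hBi.congr_fun hB.symm measurableSet_Ioo),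
    setIntegral_congr_fun measurableSet_Ioc hA, setIntegral_congr_fun measurableSet_Ioo hB,
    integral_const_mul, integral_mul_const, (integral_dens hT ha ht.2.le).2, rl,
    intervalIntegral.integral_of_le ht.1]

lemma measurable_of_right_cont {Ω : Type*} [MeasurableSpace Ω] (X : ℝ → Ω → ℝ)
    (hm : ∀ u, Measurable (X u))
    (hr : ∀ ω u, Filter.Tendsto (fun s => X s ω) (nhdsWithin u (Set.Ioi u)) (nhds (X u ω))) :
    Measurable (fun p : ℝ × Ω => X p.1 p.2) := by
  refine measurable_of_tendsto_metrizable 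
    (f := fun n : ℕ => fun p : ℝ × Ω =>
      X ((⌊((n : ℝ) + 1) * p.1⌋ + 1 : ℝ) / ((n : ℝ) + 1)) p.2) ?_ ?_
  · intro n
    have h1 : Measurable (fun q : ℤ × Ω => X ((q.1 + 1 : ℝ) / ((n : ℝ) + 1)) q.2) :=
      measurable_from_prod_countable_right (fun k => hm ((k + 1 : ℝ) / ((n : ℝ) + 1)))
    have h2 : Measurable (fun p : ℝ × Ω => ((⌊((n : ℝ) + 1) * p.1⌋ : ℤ), p.2)) := by
      fun_prop
    exact h1.comp h2
  · rw [tendsto_pi_nhds]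
    rintro ⟨u, ω⟩
    refine (hr ω u).comp ?_
    rw [tendsto_nhdsWithin_iff]
    have hlt : ∀ n : ℕ, u < (⌊((n : ℝ) + 1) * u⌋ + 1 : ℝ) / ((n : ℝ) + 1) := by
      intro n
      rw [lt_div_iff₀ (by positivity), mul_comm]
      exact Int.lt_floor_add_one _
    constructor
    · refine tendsto_of_tendsto_of_tendsto_of_le_of_le (g := fun _ => u)
        (h := fun n : ℕ => u + 1 / ((n : ℝ) + 1)) tendsto_const_nhds ?_ (fun n => (hlt n).le) ?_
      · simpa using (tendsto_one_div_add_atTop_nhds_zero_nat (𝕜 := ℝ)).const_add u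
      · intro n
        have hn : (0 : ℝ) < n + 1 := by positivity
        simp only
        have e : (u + 1 / ((n : ℝ) + 1)) * ((n : ℝ) + 1) = ((n : ℝ) + 1) * u + 1 := by
          field_simp
        rw [div_le_iff₀ hn, e]
        linarith [Int.floor_le (((n : ℝ) + 1) * u)]
    · exact Filter.Eventually.of_forall hlt

lemma mesh_interp {T θ a b w ρ : ℝ} (hθ : θ ∈ Set.Ioo (0:ℝ) 1) (haw : a ≤ w) (hwb : w ≤ b)
    (hab : a < b) (hbT : b ≤ T) (hρ0 : 0 ≤ ρ) (hρ : b - a ≤ ρ * (T - a) ^ (1 - θ)) :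
    b - w ≤ ρ * (T - w) ^ (1 - θ) := by
  have hX : 0 < T - a := by linarith
  have hx : 0 ≤ T - w := by linarith
  have e1 : (T - a) ^ (1 - θ) * (T - a) ^ θ = T - a := by
    rw [← Real.rpow_add hX]; simp
  have e2 : (T - w) ^ (1 - θ) * (T - w) ^ θ = T - w := by
    rw [← Real.rpow_add_of_nonneg hx (by linarith [hθ.2]) hθ.1.le]; simp
  have h3 : (T - w) ^ θ ≤ (T - a) ^ θ := Real.rpow_le_rpow hx (by linarith) hθ.1.le
  have hXp : 0 < (T - a) ^ θ := Real.rpow_pos_of_pos hX _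
  have hXq : 0 < (T - a) ^ (1 - θ) := Real.rpow_pos_of_pos hX _
  have hxq : 0 ≤ (T - w) ^ (1 - θ) := Real.rpow_nonneg hx _
  have h1 : (b - w) * (T - a) ≤ (b - a) * (T - w) := by nlinarith
  have h2 : (b - w) * (T - a) ≤ ρ * (T - a) ^ (1 - θ) * (T - w) :=
    h1.trans (mul_le_mul_of_nonneg_right hρ hx)
  have h4 : (T - a) ^ (1 - θ) * ((b - w) * (T - a) ^ θ) ≤ (T - a) ^ (1 - θ) * (ρ * (T - w)) := by
    calc _ = (b - w) * ((T - a) ^ (1 - θ) * (T - a) ^ θ) := by ring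
      _ ≤ _ := by rw [e1]; linarith
  have h5 := le_of_mul_le_mul_left h4 hXq
  have h6 : ρ * (T - w) ≤ ρ * (T - w) ^ (1 - θ) * (T - a) ^ θ := by
    calc ρ * (T - w) = ρ * (T - w) ^ (1 - θ) * (T - w) ^ θ := by rw [mul_assoc, e2]
      _ ≤ _ := mul_le_mul_of_nonneg_left h3 (by positivity)
  exact le_of_mul_le_mul_right (h5.trans h6) hXp

lemma dom_ineq {T θ a b ρ : ℝ} (hT : 0 < T) (hθ : θ ∈ Set.Ioo (0:ℝ) 1) (ha : 0 ≤ a)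
    (hab : a < b) (hbT : b ≤ T) (hρ0 : 0 ≤ ρ) (hρ : b - a ≤ ρ * (T - a) ^ (1 - θ))
    (m : ℝ → ℝ) (hm : MonotoneOn m (Set.Ico 0 T)) :
    ∫⁻ u in Set.Ioc a b, ENNReal.ofReal (m u - m a) ≤
      ENNReal.ofReal (ρ * T ^ (1 - θ)) *
        ∫⁻ u, ENNReal.ofReal (m (min u b) - m (min u a)) ∂(nuM T (1 - θ)) := by
  set H : ℝ → ℝ := fun u => m (min u b) - m (min u a) with hH
  have hmem : ∀ u ∈ Set.Ioo 0 T, ∀ c, 0 ≤ c → min u c ∈ Set.Ico 0 T := fun u hu c hc =>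
    ⟨le_min hu.1.le hc, (min_le_left _ _).trans_lt hu.2⟩
  have hH0 : ∀ u ∈ Set.Ioo 0 T, 0 ≤ H u := fun u hu =>
    sub_nonneg.2 (hm (hmem u hu a ha) (hmem u hu b (ha.trans hab.le)) (min_le_min le_rfl hab.le))
  have hHm : MonotoneOn H (Set.Ioo 0 T) := by
    intro u hu v hv huv
    by_cases h : u ≤ a
    · have : H u = 0 := by simp [hH, min_eq_left h, min_eq_left (h.trans hab.le)]
      rw [this]; exact hH0 v hv
    · push Not at h
      simp only [hH, min_eq_right h.le, min_eq_right (h.le.trans huv)]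
      have := hm (hmem u hu b (ha.trans hab.le)) (hmem v hv b (ha.trans hab.le))
        (min_le_min huv le_rfl)
      linarith
  have hsub : Set.Ioo a b ⊆ Set.Ioo 0 T := Set.Ioo_subset_Ioo ha hbT
  have e1 : ∫⁻ u in Set.Ioc a b, ENNReal.ofReal (m u - m a)
      = ∫⁻ u in Set.Ioo a b, ENNReal.ofReal (H u) := by
    rw [setLIntegral_congr (Ioo_ae_eq_Ioc (a := a) (b := b)).symm]
    apply setLIntegral_congr_fun measurableSet_Ioo
    intro u hu
    simp only [hH, min_eq_left hu.2.le, min_eq_right hu.1.le]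
  rw [e1, lintegral_eq_lintegral_meas_lt, lintegral_eq_lintegral_meas_lt,
    ← lintegral_const_mul' _ _ ENNReal.ofReal_ne_top]
  rotate_left
  · filter_upwards [nuM_ae] with u hu using hH0 u hu
  · exact (aemeasurable_restrict_of_monotoneOn measurableSet_Ioo hHm).mono_ac
      (withDensity_absolutelyContinuous _ _)
  · exact (ae_restrict_iff' measurableSet_Ioo).2
      (Filter.Eventually.of_forall fun u hu => hH0 u (hsub hu))
  · exact aemeasurable_restrict_of_monotoneOn measurableSet_Ioo (hHm.mono hsub)
  apply lintegral_mono
  intro s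
  simp only
  rw [Measure.restrict_apply' measurableSet_Ioo]
  set S := {u | s < H u} ∩ Set.Ioo a b with hS
  rcases S.eq_empty_or_nonempty with h | hne
  · rw [h]; simp
  have hbd : BddBelow S := ⟨a, fun u hu => hu.2.1.le⟩
  set w := sInf S with hw
  have haw : a ≤ w := le_csInf hne fun u hu => hu.2.1.le
  have hwb : w ≤ b := by
    obtain ⟨u, hu⟩ := hne
    exact (csInf_le hbd hu).trans hu.2.2.le
  have h1 : volume S ≤ ENNReal.ofReal (b - w) := by
    rw [← Real.volume_Icc]
    exact measure_mono fun u hu => ⟨csInf_le hbd hu, hu.2.2.le⟩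
  have h2 : ENNReal.ofReal (((T - w) / T) ^ (1 - θ)) ≤ nuM T (1 - θ) {u | s < H u} := by
    rw [← nuM_Ioo hT (by linarith [hθ.2]) (ha.trans haw) (hwb.trans hbT)]
    apply measure_mono
    intro v hv
    obtain ⟨u, hu, huv⟩ := exists_lt_of_csInf_lt hne hv.1
    exact lt_of_lt_of_le hu.1 (hHm (hsub hu.2) ⟨(ha.trans haw).trans_lt hv.1, hv.2⟩ huv.le)
  refine h1.trans (le_trans ?_ (mul_le_mul_right h2 _))
  rw [← ENNReal.ofReal_mul (by positivity)]
  apply ENNReal.ofReal_le_ofReal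
  refine (mesh_interp hθ haw hwb hab hbT hρ0 hρ).trans (le_of_eq ?_)
  rw [Real.div_rpow (by linarith) hT.le]
  field_simp

lemma phi_bound {T θ b : ℝ} (hT : 0 < T) (hθ : θ ∈ Set.Ioo (0:ℝ) 1) 
    (hb : b ∈ Set.Ico 0 T) (m : ℝ → ℝ) (hm : MonotoneOn m (Set.Ico 0 T))
    (s : ℕ → ℝ) (h0 : s 0 = 0) (hs : Monotone s) (hsT : ∀ j, s j < T) (K : ℕ) (hK : b ≤ s K) :
    ∫⁻ u, ENNReal.ofReal (m (min u b)) ∂(nuM T (1 - θ)) ≤ ENNReal.ofReal (m 0) +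
      ∑ j ∈ Finset.range K, (if s j < b then
        ENNReal.ofReal (((T - s j) / T) ^ (1 - θ)) * ENNReal.ofReal (m (s (j + 1)) - m (s j))
        else 0) := by
  have hprob := nuM_prob hT (show 0 < 1 - θ by linarith [hθ.2])
  have hs0 : ∀ j, 0 ≤ s j := fun j => h0 ▸ hs (Nat.zero_le j)
  have key : ∀ u ∈ Set.Ioo 0 T, ∀ K : ℕ, ENNReal.ofReal (m (min (min u b) (s K))) ≤
      ENNReal.ofReal (m 0) + ∑ j ∈ Finset.range K, (Set.Ioo (s j) T).indicator
        (fun _ => if s j < b then ENNReal.ofReal (m (s (j + 1)) - m (s j)) else 0) u := by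
    intro u hu K
    induction K with
    | zero =>
      simp only [h0, Finset.range_zero, Finset.sum_empty, add_zero]
      rw [min_eq_right (le_min hu.1.le hb.1)]
    | succ K ih =>
      rw [Finset.sum_range_succ, ← add_assoc]
      by_cases h : s K < min u b
      · have h' := lt_min_iff.1 h
        rw [Set.indicator_of_mem (show u ∈ Set.Ioo (s K) T from ⟨h'.1, hu.2⟩), if_pos h'.2]
        rw [min_eq_right h.le] at ih
        refine le_trans ?_ (add_le_add ih le_rfl)
        refine le_trans ?_ (ENNReal.ofReal_add_le)
        apply ENNReal.ofReal_le_ofReal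
        have : m (min (min u b) (s (K + 1))) ≤ m (s (K + 1)) := by
          apply hm _ ⟨hs0 _, hsT _⟩ (min_le_right _ _)
          exact ⟨le_min (le_min hu.1.le hb.1) (hs0 _), (min_le_right _ _).trans_lt (hsT _)⟩
        linarith
      · push Not at h
        rw [min_eq_left h] at ih
        rw [min_eq_left (h.trans (hs (Nat.le_succ K)))]
        exact ih.trans le_self_add
  calc _ ≤ ∫⁻ u, (ENNReal.ofReal (m 0) + ∑ j ∈ Finset.range K, (Set.Ioo (s j) T).indicator
        (fun _ => if s j < b then ENNReal.ofReal (m (s (j + 1)) - m (s j)) else 0) u)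
          ∂(nuM T (1 - θ)) := by
        apply lintegral_mono_ae
        filter_upwards [nuM_ae] with u hu
        have := key u hu K
        rwa [min_eq_left ((min_le_right _ _).trans hK)] at this
    _ = _ := by
        rw [lintegral_add_left measurable_const, lintegral_finsetSum]
        · simp only [lintegral_const, measure_univ, mul_one]
          congr 1
          apply Finset.sum_congr rfl
          intro j _
          rw [lintegral_indicator measurableSet_Ioo, lintegral_const,
            Measure.restrict_apply_univ, nuM_Ioo hT (by linarith [hθ.2]) (hs0 _) (hsT _).le]
          split_ifs
          · rw [mul_comm]
          · simp
        · intro j _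
          exact measurable_const.indicator measurableSet_Ioo

lemma seq_exists {T θ ε : ℝ} (hT : 0 < T) (hθ : θ ∈ Set.Ioo (0:ℝ) 1) (hε : 0 < ε) :
    ∃ s : ℕ → ℝ, s 0 = 0 ∧ (∀ j, s j < s (j + 1)) ∧ (∀ j, s j < T) ∧
      (∀ j, s (j + 1) - s j ≤ ε * (T - s j) ^ (1 - θ)) ∧
      (∀ j, 2 * ε ≤ (T - s j) ^ θ → s (j + 1) - s j = ε * (T - s j) ^ (1 - θ)) ∧
      (∀ j, s (j + 1) - s j ≤ 2 * (s (j + 2) - s (j + 1))) ∧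
      Filter.Tendsto s Filter.atTop (nhds T) := by
  set d : ℝ → ℝ := fun x => min (x / 2) (ε * x ^ (1 - θ)) with hd
  set y : ℕ → ℝ := fun j => Nat.rec T (fun _ x => x - d x) j with hy
  have y0 : y 0 = T := rfl
  have yS : ∀ j, y (j + 1) = y j - d (y j) := fun j => rfl
  have dpos : ∀ x, 0 < x → 0 < d x := fun x hx =>
    lt_min (by linarith) (mul_pos hε (Real.rpow_pos_of_pos hx _))
  have dle : ∀ x, d x ≤ x / 2 := fun x => min_le_left _ _
  have ypos : ∀ j, 0 < y j := by
    intro j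
    induction j with
    | zero => exact hT
    | succ j ih => rw [yS]; linarith [dle (y j)]
  have hθ1 : 0 < 1 - θ := by linarith [hθ.2]
  have yanti : Antitone y := antitone_nat_of_succ_le fun j => by
    rw [yS]; linarith [dpos _ (ypos j)]
  have hdcont : Continuous d := by
    have : Continuous (fun x : ℝ => x ^ (1 - θ)) := Real.continuous_rpow_const hθ1.le
    fun_prop
  have hlim : Filter.Tendsto y Filter.atTop (nhds 0) := by
    have h1 := tendsto_atTop_ciInf yanti ⟨0, by rintro _ ⟨j, rfl⟩; exact (ypos j).le⟩
    set l := ⨅ j, y j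
    have hl0 : 0 ≤ l := le_ciInf fun j => (ypos j).le
    have h2 : Filter.Tendsto (fun j => y (j + 1)) Filter.atTop (nhds (l - d l)) := by
      simp only [yS]
      exact h1.sub ((hdcont.tendsto l).comp h1)
    have h3 := tendsto_nhds_unique ((Filter.tendsto_add_atTop_iff_nat 1).2 h1) h2
    have : l = 0 := by
      by_contra hne
      have := dpos l (lt_of_le_of_ne hl0 (Ne.symm hne))
      linarith
    rwa [this] at h1
  refine ⟨fun j => T - y j, by simp [y0], ?_, ?_, ?_, ?_, ?_, ?_⟩
  · intro j
    simp only [yS]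
    linarith [dpos _ (ypos j)]
  · intro j
    linarith [ypos j]
  · intro j
    simp only [yS, _root_.sub_sub_cancel]
    have : d (y j) ≤ ε * y j ^ (1 - θ) := min_le_right _ _
    linarith
  · intro j hj
    simp only [yS, _root_.sub_sub_cancel] at hj ⊢
    have : d (y j) = ε * y j ^ (1 - θ) := by
      apply min_eq_right
      have e1 : y j ^ (1 - θ) * y j ^ θ = y j := by
        rw [← Real.rpow_add (ypos j)]; simp
      have := mul_le_mul_of_nonneg_left hj (Real.rpow_nonneg (ypos j).le (1 - θ))
      linarith
    linarith
  · intro j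
    have h1 : d (y j) ≤ 2 * d (y (j + 1)) := by
      have hh : y j / 2 ≤ y (j + 1) := by rw [yS]; linarith [dle (y j)]
      have hr : y j ^ (1 - θ) ≤ 2 * y (j + 1) ^ (1 - θ) := by
        have h2 : (y j) ^ (1 - θ) ≤ (2 * y (j + 1)) ^ (1 - θ) :=
          Real.rpow_le_rpow (ypos j).le (by linarith) hθ1.le
        rw [Real.mul_rpow (by norm_num) (ypos (j + 1)).le] at h2
        have h3 : (2 : ℝ) ^ (1 - θ) ≤ 2 := by
          calc (2 : ℝ) ^ (1 - θ) ≤ 2 ^ (1 : ℝ) :=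
                Real.rpow_le_rpow_of_exponent_le (by norm_num) (by linarith [hθ.1])
            _ = 2 := by simp
        exact h2.trans (mul_le_mul_of_nonneg_right h3 (Real.rpow_nonneg (ypos (j + 1)).le _))
      have : d (y j) / 2 ≤ d (y (j + 1)) := by
        apply le_min
        · have := dle (y j); linarith
        · have : d (y j) ≤ ε * y j ^ (1 - θ) := min_le_right _ _
          nlinarith
      linarith
    simp only [yS j, yS (j + 1)] at h1 ⊢
    linarith
  · simpa using hlim.const_sub T

lemma mesh_le {T θ δ : ℝ} {n : ℕ} {t : ℕ → ℝ} (hδ : 0 ≤ δ)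
    (h : ∀ i < n, (t (i + 1) - t i) / (T - t i) ^ (1 - θ) ≤ δ) : meshTheta T θ n t ≤ δ :=
  Real.iSup_le (fun i => Real.iSup_le (fun hi => h i (Finset.mem_range.1 hi)) hδ) hδ

lemma le_mesh {T θ : ℝ} {n : ℕ} {t : ℕ → ℝ} {i : ℕ} (hi : i < n) :
    (t (i + 1) - t i) / (T - t i) ^ (1 - θ) ≤ meshTheta T θ n t := by
  have hb : BddAbove (Set.range fun i => ⨆ _ : i ∈ Finset.range n,
      (t (i + 1) - t i) / (T - t i) ^ (1 - θ)) := by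
    refine ⟨∑ j ∈ Finset.range n, |(t (j + 1) - t j) / (T - t j) ^ (1 - θ)|, ?_⟩
    rintro _ ⟨j, rfl⟩
    refine Real.iSup_le (fun hj => ?_) (Finset.sum_nonneg fun _ _ => abs_nonneg _)
    exact (le_abs_self _).trans (Finset.single_le_sum
      (f := fun j => |(t (j + 1) - t j) / (T - t j) ^ (1 - θ)|) (fun _ _ => abs_nonneg _) hj)
  have := le_ciSup hb i
  rwa [ciSup_pos (Finset.mem_range.2 hi)] at this

lemma net_mono {T : ℝ} {n : ℕ} {t : ℕ → ℝ} (h : IsTimeNet T n t) :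
    ∀ i j, i ≤ j → j ≤ n → t i ≤ t j := by
  intro i j hij hj
  induction j, hij using Nat.le_induction with
  | base => exact le_rfl
  | succ j hij ih => exact (ih (by omega)).trans (h.2.2.2 j (by omega)).le

lemma aemeas_min {T a b : ℝ} (hb : 0 ≤ b) (m : ℝ → ℝ) (hm : MonotoneOn m (Set.Ico 0 T)) :
    AEMeasurable (fun u => ENNReal.ofReal (m (min u b))) (nuM T a) := by
  apply ENNReal.measurable_ofReal.comp_aemeasurable
  refine (aemeasurable_restrict_of_monotoneOn measurableSet_Ioo ?_).mono_ac
      (withDensity_absolutelyContinuous _ _)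
  intro u hu v hv huv
  exact hm ⟨le_min hu.1.le hb, (min_le_left _ _).trans_lt hu.2⟩
    ⟨le_min hv.1.le hb, (min_le_left _ _).trans_lt hv.2⟩ (min_le_min huv le_rfl)

lemma W_le {T a : ℝ} (hT : 0 < T) (m : ℝ → ℝ) (hm : MonotoneOn m (Set.Ico 0 T)) (C : ℝ≥0∞)
    (h : ∀ b ∈ Set.Ico 0 T, ∫⁻ u, ENNReal.ofReal (m (min u b)) ∂(nuM T a) ≤ C) :
    ∫⁻ u, ENNReal.ofReal (m u) ∂(nuM T a) ≤ C := by
  set b : ℕ → ℝ := fun n => T - T * (1 / ((n : ℝ) + 1)) with hb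
  have hbl : Filter.Tendsto b Filter.atTop (nhds T) := by
    have := ((tendsto_one_div_add_atTop_nhds_zero_nat (𝕜 := ℝ)).const_mul T).const_sub T
    rwa [mul_zero, sub_zero] at this
  have hbm : ∀ n, b n ∈ Set.Ico 0 T := by
    intro n
    have h1 : (0 : ℝ) < 1 / ((n : ℝ) + 1) := by positivity
    have h2 : 1 / ((n : ℝ) + 1) ≤ 1 := by
      rw [div_le_one (by positivity)]; linarith [Nat.cast_nonneg (α := ℝ) n]
    constructor
    · simp only [hb]; nlinarith
    · simp only [hb]; nlinarith
  calc _ ≤ ∫⁻ u, Filter.liminf (fun n => ENNReal.ofReal (m (min u (b n)))) Filter.atTop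
          ∂(nuM T a) := by
        apply lintegral_mono_ae
        filter_upwards [nuM_ae] with u hu
        have : ∀ᶠ n in Filter.atTop, ENNReal.ofReal (m (min u (b n))) = ENNReal.ofReal (m u) := by
          filter_upwards [hbl.eventually (lt_mem_nhds hu.2)] with n hn
          rw [min_eq_left hn.le]
        rw [Filter.liminf_congr this, Filter.liminf_const]
    _ ≤ Filter.liminf (fun n => ∫⁻ u, ENNReal.ofReal (m (min u (b n))) ∂(nuM T a)) Filter.atTop :=
        lintegral_liminf_le' (fun n => aemeas_min (hbm n).1 m hm)
    _ ≤ Filter.liminf (fun _ : ℕ => C) Filter.atTop :=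
        Filter.liminf_le_liminf (Filter.Eventually.of_forall fun n => h _ (hbm n))
    _ = C := Filter.liminf_const _

lemma min_le_W {T a b : ℝ} (hb : b ∈ Set.Ico 0 T) (m : ℝ → ℝ) (hm : MonotoneOn m (Set.Ico 0 T)) :
    ∫⁻ u, ENNReal.ofReal (m (min u b)) ∂(nuM T a) ≤ ∫⁻ u, ENNReal.ofReal (m u) ∂(nuM T a) := by
  apply lintegral_mono_ae
  filter_upwards [nuM_ae] with u hu
  exact ENNReal.ofReal_le_ofReal (hm ⟨le_min hu.1.le hb.1, (min_le_left _ _).trans_lt hu.2⟩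
    ⟨hu.1.le, hu.2⟩ (min_le_left _ _))

lemma sq_upper {T θ : ℝ} (hT : 0 < T) (hθ : θ ∈ Set.Ioo (0:ℝ) 1) (m : ℝ → ℝ)
    (hm0 : ∀ u, 0 ≤ m u) (hm : MonotoneOn m (Set.Ico 0 T)) (n : ℕ) (t : ℕ → ℝ)
    (ht : IsTimeNet T n t) :
    ∑ i ∈ Finset.range n, ∫⁻ u in Set.Ioc (t i) (t (i + 1)), ENNReal.ofReal (m u - m (t i)) ≤
      ENNReal.ofReal (meshTheta T θ n t * T ^ (1 - θ)) *
        ∫⁻ u, ENNReal.ofReal (m u) ∂(nuM T (1 - θ)) := by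
  have hmono := net_mono ht
  have ht0 : ∀ i ≤ n, 0 ≤ t i := fun i hi => by
    have := hmono 0 i (Nat.zero_le _) hi; rwa [ht.2.1] at this
  have htT : ∀ i ≤ n, t i ≤ T := fun i hi => by
    have := hmono i n hi le_rfl; rwa [ht.2.2.1] at this
  have hpos : ∀ i < n, 0 < T - t i := fun i hi => by
    have := ht.2.2.2 i hi
    have := htT (i + 1) hi
    linarith
  have hρ : 0 ≤ meshTheta T θ n t := by
    refine le_trans ?_ (le_mesh (i := 0) ht.1)
    have := ht.2.2.2 0 ht.1
    have := hpos 0 ht.1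
    apply div_nonneg (by linarith)
    positivity
  have hmeas : ∀ i ≤ n, AEMeasurable (fun u => ENNReal.ofReal (m (min u (t i)))) (nuM T (1 - θ)) :=
    fun i hi => aemeas_min (ht0 i hi) m hm
  have hmin : ∀ u ∈ Set.Ioo 0 T, ∀ i ≤ n, min u (t i) ∈ Set.Ico 0 T := fun u hu i hi =>
    ⟨le_min hu.1.le (ht0 i hi), (min_le_left _ _).trans_lt hu.2⟩
  calc _ ≤ ∑ i ∈ Finset.range n, ENNReal.ofReal (meshTheta T θ n t * T ^ (1 - θ)) *
        ∫⁻ u, ENNReal.ofReal (m (min u (t (i + 1))) - m (min u (t i))) ∂(nuM T (1 - θ)) := by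
        apply Finset.sum_le_sum
        intro i hi
        have hi := Finset.mem_range.1 hi
        apply dom_ineq hT hθ (ht0 i hi.le) (ht.2.2.2 i hi) (htT _ hi) hρ _ m hm
        have hp := hpos i hi
        rw [← div_le_iff₀ (by positivity)]
        exact le_mesh hi
    _ = ENNReal.ofReal (meshTheta T θ n t * T ^ (1 - θ)) * ∫⁻ u, ∑ i ∈ Finset.range n,
          ENNReal.ofReal (m (min u (t (i + 1))) - m (min u (t i))) ∂(nuM T (1 - θ)) := by
        rw [← Finset.mul_sum, lintegral_finsetSum']
        intro i hi
        have hi := Finset.mem_range.1 hi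
        have e : ∀ u, ENNReal.ofReal (m (min u (t (i + 1))) - m (min u (t i))) =
            ENNReal.ofReal (m (min u (t (i + 1)))) - ENNReal.ofReal (m (min u (t i))) :=
          fun u => ENNReal.ofReal_sub _ (hm0 _)
        simp only [e]
        exact (hmeas _ hi).sub (hmeas _ hi.le)
    _ ≤ _ := by
        refine mul_le_mul_right ?_ _
        apply lintegral_mono_ae
        filter_upwards [nuM_ae] with u hu
        rw [← ENNReal.ofReal_sum_of_nonneg]
        · apply ENNReal.ofReal_le_ofReal
          rw [Finset.sum_range_sub (fun i => m (min u (t i)))]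
          have : m (min u (t n)) ≤ m u := hm (hmin u hu n le_rfl) ⟨hu.1.le, hu.2⟩ (min_le_left _ _)
          linarith [hm0 (min u (t 0))]
        · intro i hi
          have hi := Finset.mem_range.1 hi
          exact sub_nonneg.2 (hm (hmin u hu i hi.le) (hmin u hu _ hi)
            (min_le_min le_rfl (ht.2.2.2 i hi).le))

lemma net_of_seq {T θ c δ : ℝ} (hθ : θ ∈ Set.Ioo (0:ℝ) 1) (m : ℝ → ℝ) (hc : 0 < c) (hδ : 0 < δ)
    (h : ∀ (n : ℕ) (t : ℕ → ℝ), IsTimeNet T n t →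
      ∑ i ∈ Finset.range n, ∫⁻ u in Set.Ioc (t i) (t (i + 1)), ENNReal.ofReal (m u - m (t i)) ≤
        ENNReal.ofReal (c * meshTheta T θ n t))
    (r : ℕ → ℝ) (r0 : r 0 = 0) (hr : ∀ i, r i < r (i + 1)) (hrT : ∀ i, r i < T)
    (hd : ∀ i, r (i + 1) - r i ≤ δ * (T - r i) ^ (1 - θ)) (N : ℕ) (hN : (T - r N) ^ θ ≤ δ) :
    ∑ i ∈ Finset.range N, ∫⁻ u in Set.Ioc (r i) (r (i + 1)), ENNReal.ofReal (m u - m (r i)) ≤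
      ENNReal.ofReal (c * δ) := by
  set t : ℕ → ℝ := fun i => if i ≤ N then r i else T with ht
  have hnet : IsTimeNet T (N + 1) t := by
    refine ⟨by omega, by simp [ht, r0], by simp [ht], fun i hi => ?_⟩
    simp only [ht]
    rw [if_pos (by omega)]
    split_ifs
    · exact hr i
    · exact hrT i
  have hmesh : meshTheta T θ (N + 1) t ≤ δ := by
    apply mesh_le hδ.le
    intro i hi
    simp only [ht]
    rw [if_pos (show i ≤ N by omega)]
    have hp : 0 < T - r i := by linarith [hrT i]
    rw [div_le_iff₀ (by positivity)]
    split_ifs with h1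
    · exact hd i
    · have : i = N := by omega
      subst this
      have e1 : (T - r i) ^ θ * (T - r i) ^ (1 - θ) = T - r i := by
        rw [← Real.rpow_add hp]; simp
      calc T - r i = (T - r i) ^ θ * (T - r i) ^ (1 - θ) := e1.symm
        _ ≤ _ := mul_le_mul_of_nonneg_right hN (by positivity)
  have := h _ t hnet
  rw [Finset.sum_range_succ] at this
  refine le_trans ?_ ((le_self_add.trans this).trans (ENNReal.ofReal_le_ofReal
    (mul_le_mul_of_nonneg_left hmesh hc.le)))
  apply le_of_eq
  apply Finset.sum_congr rfl
  intro i hi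
  have := Finset.mem_range.1 hi
  simp only [ht]
  rw [if_pos (by omega), if_pos (by omega)]

lemma step_lower {T : ℝ} (m : ℝ → ℝ) (hm : MonotoneOn m (Set.Ico 0 T)) {x y z : ℝ}
    (hx : 0 ≤ x) (hxy : x ≤ y) (hyz : y ≤ z) (hz : z < T) :
    ENNReal.ofReal (z - y) * ENNReal.ofReal (m y - m x) ≤
      ∫⁻ u in Set.Ioc x z, ENNReal.ofReal (m u - m x) := by
  calc _ = ∫⁻ u in Set.Ioc y z, ENNReal.ofReal (m y - m x) := by
        rw [lintegral_const, Measure.restrict_apply_univ, Real.volume_Ioc, mul_comm]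
    _ ≤ ∫⁻ u in Set.Ioc y z, ENNReal.ofReal (m u - m x) := by
        apply setLIntegral_mono' measurableSet_Ioc
        intro u hu
        apply ENNReal.ofReal_le_ofReal
        have := hm ⟨hx.trans hxy, hyz.trans_lt hz⟩
          ⟨(hx.trans hxy).trans hu.1.le, hu.2.trans_lt hz⟩ hu.1.le
        linarith
    _ ≤ _ := lintegral_mono_set (Set.Ioc_subset_Ioc_left hxy)

lemma sum_two_mul (f : ℕ → ℝ≥0∞) (N : ℕ) : ∑ j ∈ Finset.range (2 * N), f j =
    ∑ i ∈ Finset.range N, f (2 * i) + ∑ i ∈ Finset.range N, f (2 * i + 1) := by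
  induction N with
  | zero => simp
  | succ N ih =>
    rw [show 2 * (N + 1) = 2 * N + 1 + 1 by ring, Finset.sum_range_succ, Finset.sum_range_succ, ih,
      Finset.sum_range_succ, Finset.sum_range_succ]
    ring

lemma phi_le_of_nets {T θ c b : ℝ} (hT : 0 < T) (hθ : θ ∈ Set.Ioo (0:ℝ) 1) (m : ℝ → ℝ)
    (hm : MonotoneOn m (Set.Ico 0 T)) (hc : 0 < c)
    (h : ∀ (n : ℕ) (t : ℕ → ℝ), IsTimeNet T n t →
      ∑ i ∈ Finset.range n, ∫⁻ u in Set.Ioc (t i) (t (i + 1)), ENNReal.ofReal (m u - m (t i)) ≤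
        ENNReal.ofReal (c * meshTheta T θ n t)) (hb : b ∈ Set.Ico 0 T) :
    ∫⁻ u, ENNReal.ofReal (m (min u b)) ∂(nuM T (1 - θ)) ≤
      ENNReal.ofReal (m 0) + ENNReal.ofReal (8 * c / T ^ (1 - θ)) := by
  have hTb : 0 < T - b := by linarith [hb.2]
  set ε : ℝ := (T - b) ^ θ / 2 with hε
  have hε0 : 0 < ε := by positivity
  obtain ⟨s, s0, sS, sT, sd, sde, s2, slim⟩ := seq_exists hT hθ hε0
  have smono : Monotone s := monotone_nat_of_le_succ fun j => (sS j).le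
  have sneg : ∀ j, 0 ≤ s j := fun j => s0 ▸ smono (Nat.zero_le j)
  have hθ1 : 0 < 1 - θ := by linarith [hθ.2]
  have hTp : 0 < T ^ (1 - θ) := by positivity
  -- choice of the number of points
  obtain ⟨N, hN1, hNb, hN2⟩ : ∃ N : ℕ, 1 ≤ N ∧ b ≤ s N ∧ (T - s N) ^ θ ≤ 2 * ε := by
    obtain ⟨N, hN, hN'⟩ := ((slim.eventually (lt_mem_nhds hb.2)).and
      (Filter.eventually_ge_atTop 1)).exists
    refine ⟨N, hN', hN.le, ?_⟩
    have : (T - s N) ^ θ ≤ (T - b) ^ θ :=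
      Real.rpow_le_rpow (by linarith [sT N]) (by linarith) hθ.1.le
    rw [hε]; linarith
  have hfar : ∀ j, N ≤ j → (T - s j) ^ θ ≤ 2 * ε := fun j hj =>
    (Real.rpow_le_rpow (by linarith [sT j]) (by linarith [smono hj]) hθ.1.le).trans hN2
  have sdd : ∀ j k, k ≤ j → s (j + 1) - s j ≤ ε * (T - s k) ^ (1 - θ) := fun j k hkj =>
    (sd j).trans (mul_le_mul_of_nonneg_left (Real.rpow_le_rpow (by linarith [sT j])
      (by linarith [smono hkj]) hθ1.le) hε0.le)
  have hA := net_of_seq hθ m hc (show 0 < 2 * ε by linarith) h (fun i => s (2 * i)) (by simp [s0])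
    (fun i => (sS (2 * i)).trans (sS _)) (fun i => sT _)
    (fun i => by
      have h1 := sdd (2 * i) (2 * i) le_rfl
      have h2 := sdd (2 * i + 1) (2 * i) (by omega)
      change s (2 * i + 1 + 1) - s (2 * i) ≤ _
      linarith) N (hfar _ (by omega))
  have hB := net_of_seq hθ m hc (show 0 < 2 * ε by linarith) h (fun i => s (2 * i - 1)) (by simp [s0])
    (fun i => by
      rcases i with _ | i
      · exact sS 0
      · exact (sS (2 * i + 1)).trans (sS _)) (fun i => sT _)
    (fun i => by
      rcases i with _ | i
      · have h1 := sdd 0 0 le_rfl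
        change s (0 + 1) - s 0 ≤ 2 * ε * (T - s 0) ^ (1 - θ)
        have : 0 ≤ ε * (T - s 0) ^ (1 - θ) := by linarith [sS 0]
        linarith
      · have h1 := sdd (2 * i + 1) (2 * i + 1) le_rfl
        have h2 := sdd (2 * i + 1 + 1) (2 * i + 1) (by omega)
        change s (2 * i + 1 + 1 + 1) - s (2 * i + 1) ≤ 2 * ε * (T - s (2 * i + 1)) ^ (1 - θ)
        linarith) (N + 1) (hfar _ (by omega))
  set E : ℕ → ℝ≥0∞ := fun j => ∫⁻ u in Set.Ioc (s j) (s (j + 2)), ENNReal.ofReal (m u - m (s j))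
    with hE
  have hsum : ∑ j ∈ Finset.range (2 * N), E j ≤ ENNReal.ofReal (4 * c * ε) := by
    rw [sum_two_mul, show 4 * c * ε = c * (2 * ε) + c * (2 * ε) by ring,
      ENNReal.ofReal_add (by positivity) (by positivity)]
    refine add_le_add hA ?_
    rw [Finset.sum_range_succ'] at hB
    exact le_self_add.trans hB
  refine (phi_bound hT hθ hb m hm s s0 smono sT (2 * N) (hNb.trans (smono (by omega)))).trans ?_
  refine add_le_add le_rfl ?_
  calc _ ≤ ∑ j ∈ Finset.range (2 * N), ENNReal.ofReal (2 / (ε * T ^ (1 - θ))) * E j := by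
        apply Finset.sum_le_sum
        intro j _
        split_ifs with hj
        · refine le_trans ?_ (mul_le_mul_right (step_lower m hm (sneg j) (sS j).le
            (sS (j + 1)).le (sT _)) _)
          rw [← mul_assoc, ← ENNReal.ofReal_mul (p := 2 / (ε * T ^ (1 - θ))) (by positivity)]
          gcongr
          have h1 : 2 * ε ≤ (T - s j) ^ θ := by
            rw [hε]
            have : (T - b) ^ θ ≤ (T - s j) ^ θ := 
              Real.rpow_le_rpow hTb.le (by linarith) hθ.1.le
            linarith
          have h2 := s2 j
          rw [sde j h1] at h2
          rw [Real.div_rpow (by linarith [sT j]) hT.le, div_mul_eq_mul_div,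
            div_le_div_iff₀ hTp (by positivity)]
          have h3 := mul_le_mul_of_nonneg_right h2 hTp.le
          change _ ≤ 2 * (s (j + 2) - s (j + 1)) * T ^ (1 - θ)
          linarith
        · exact zero_le
    _ = ENNReal.ofReal (2 / (ε * T ^ (1 - θ))) * ∑ j ∈ Finset.range (2 * N), E j := by
        rw [Finset.mul_sum]
    _ ≤ ENNReal.ofReal (2 / (ε * T ^ (1 - θ))) * ENNReal.ofReal (4 * c * ε) := by gcongr
    _ = _ := by
        rw [← ENNReal.ofReal_mul (by positivity)]
        congr 1
        field_simp
        ring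

lemma ii_iff {T θ : ℝ} (hT : 0 < T) (hθ : θ ∈ Set.Ioo (0:ℝ) 1) (m : ℝ → ℝ)
    (hm0 : ∀ u, 0 ≤ m u) (hm : MonotoneOn m (Set.Ico 0 T)) :
    (∃ c : ℝ, 0 < c ∧ ∀ (n : ℕ) (t : ℕ → ℝ), IsTimeNet T n t →
      ∑ i ∈ Finset.range n, ∫⁻ u in Set.Ioc (t i) (t (i + 1)), ENNReal.ofReal (m u - m (t i)) ≤
        ENNReal.ofReal (c * meshTheta T θ n t)) ↔
    ∫⁻ u, ENNReal.ofReal (m u) ∂(nuM T (1 - θ)) < ⊤ := by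
  constructor
  · rintro ⟨c, hc, h⟩
    refine (W_le hT m hm _ fun b hb => phi_le_of_nets hT hθ m hm hc h hb).trans_lt ?_
    exact ENNReal.add_lt_top.2 ⟨ENNReal.ofReal_lt_top, ENNReal.ofReal_lt_top⟩
  · intro hW
    set W := ∫⁻ u, ENNReal.ofReal (m u) ∂(nuM T (1 - θ)) with hWd
    have hTp : 0 < T ^ (1 - θ) := by positivity
    refine ⟨T ^ (1 - θ) * (W.toReal + 1), by positivity, fun n t ht => ?_⟩
    refine (sq_upper hT hθ m hm0 hm n t ht).trans ?_
    have hρ : 0 ≤ meshTheta T θ n t :=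
      Real.iSup_nonneg fun i => Real.iSup_nonneg fun hi => by
        have hi := Finset.mem_range.1 hi
        have h1 := ht.2.2.2 i hi
        have h2 := net_mono ht i n hi.le le_rfl
        rw [ht.2.2.1] at h2
        exact div_nonneg (by linarith) (Real.rpow_nonneg (by linarith) _)
    rw [← hWd, ← ENNReal.ofReal_toReal hW.ne, ← ENNReal.ofReal_mul (by positivity)]
    apply ENNReal.ofReal_le_ofReal
    have : 0 ≤ meshTheta T θ n t * T ^ (1 - θ) := by positivity
    rw [ENNReal.toReal_ofReal ENNReal.toReal_nonneg]
    nlinarith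

lemma iii_iff {T θ : ℝ} (hT : 0 < T) (hθ : θ ∈ Set.Ioo (0:ℝ) 1) (M : ℝ → ℝ≥0∞) :
    (∫⁻ t in Set.Ioo (0:ℝ) T, ENNReal.ofReal ((T - t) ^ (-θ)) * M t) < ⊤ ↔
    ∫⁻ u, M u ∂(nuM T (1 - θ)) < ⊤ := by
  have hθ1 : 0 < 1 - θ := by linarith [hθ.2]
  have hk : 0 < (1 - θ) / T ^ (1 - θ) := by positivity
  rw [nuM, lintegral_withDensity_eq_lintegral_mul_non_measurable _ (measurable_dens T _) (by simp)]
  have : ∀ u, ((fun u => ENNReal.ofReal ((1 - θ) / T ^ (1 - θ) * (T - u) ^ (1 - θ - 1))) * M) u =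
      ENNReal.ofReal ((1 - θ) / T ^ (1 - θ)) * (ENNReal.ofReal ((T - u) ^ (-θ)) * M u) := by
    intro u
    simp only [Pi.mul_apply]
    rw [ENNReal.ofReal_mul hk.le, mul_assoc, show 1 - θ - 1 = -θ by ring]
  simp only [this]
  rw [lintegral_const_mul' _ _ ENNReal.ofReal_ne_top]
  constructor
  · intro h
    exact ENNReal.mul_lt_top ENNReal.ofReal_lt_top h
  · intro h
    exact ENNReal.lt_top_of_mul_ne_top_right h.ne (by simpa using hk)

section prob

variable {Ω : Type*} {mΩ : MeasurableSpace Ω} {μ : Measure Ω} [IsProbabilityMeasure μ]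
  {ℱ : Filtration ℝ mΩ} {T : ℝ} {L : ℝ → Ω → ℝ}

lemma cov_eq (hAdapted : ∀ t ∈ Set.Ico (0:ℝ) T, StronglyMeasurable[ℱ t] (L t))
    (hL2 : ∀ t ∈ Set.Ico (0:ℝ) T, MemLp (L t) 2 μ)
    (hMart : ∀ s t : ℝ, s ∈ Set.Ico (0:ℝ) T → t ∈ Set.Ico (0:ℝ) T → s ≤ t →
      μ[L t | ℱ s] =ᵐ[μ] L s) {s t : ℝ} (hs : s ∈ Set.Ico 0 T) (ht : t ∈ Set.Ico 0 T)
    (hst : s ≤ t) : ∫ ω, L s ω * L t ω ∂μ = ∫ ω, L s ω ^ 2 ∂μ := by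
  have hi : Integrable (L s * L t) μ := (hL2 s hs).integrable_mul (hL2 t ht)
  have h1 := condExp_mul_of_stronglyMeasurable_left (hAdapted s hs) hi
    ((hL2 t ht).integrable (by norm_num))
  calc ∫ ω, L s ω * L t ω ∂μ = ∫ ω, (μ[L s * L t | ℱ s]) ω ∂μ :=
        (integral_condExp (ℱ.le s)).symm
    _ = ∫ ω, L s ω ^ 2 ∂μ := by
        apply integral_congr_ae
        filter_upwards [h1, hMart s t hs ht hst] with ω h1 h2
        rw [h1, Pi.mul_apply, h2, sq]

lemma cov_min (hAdapted : ∀ t ∈ Set.Ico (0:ℝ) T, StronglyMeasurable[ℱ t] (L t))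
    (hL2 : ∀ t ∈ Set.Ico (0:ℝ) T, MemLp (L t) 2 μ)
    (hMart : ∀ s t : ℝ, s ∈ Set.Ico (0:ℝ) T → t ∈ Set.Ico (0:ℝ) T → s ≤ t →
      μ[L t | ℱ s] =ᵐ[μ] L s) {s t : ℝ} (hs : s ∈ Set.Ico 0 T) (ht : t ∈ Set.Ico 0 T) :
    ∫ ω, L s ω * L t ω ∂μ = ∫ ω, L (min s t) ω ^ 2 ∂μ := by
  rcases le_total s t with h | h
  · rw [min_eq_left h, cov_eq hAdapted hL2 hMart hs ht h]
  · rw [min_eq_right h, ← cov_eq hAdapted hL2 hMart ht hs h]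
    simp only [mul_comm]

lemma incr_eq (hAdapted : ∀ t ∈ Set.Ico (0:ℝ) T, StronglyMeasurable[ℱ t] (L t))
    (hL2 : ∀ t ∈ Set.Ico (0:ℝ) T, MemLp (L t) 2 μ)
    (hMart : ∀ s t : ℝ, s ∈ Set.Ico (0:ℝ) T → t ∈ Set.Ico (0:ℝ) T → s ≤ t →
      μ[L t | ℱ s] =ᵐ[μ] L s) {s t : ℝ} (hs : s ∈ Set.Ico 0 T) (ht : t ∈ Set.Ico 0 T)
    (hst : s ≤ t) :
    ∫ ω, (L t ω - L s ω) ^ 2 ∂μ = ∫ ω, L t ω ^ 2 ∂μ - ∫ ω, L s ω ^ 2 ∂μ := by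
  have hi : Integrable (fun ω => L s ω * L t ω) μ := (hL2 s hs).integrable_mul (hL2 t ht)
  have e : ∀ ω, (L t ω - L s ω) ^ 2 = (L t ω ^ 2 + L s ω ^ 2) - 2 * (L s ω * L t ω) := by
    intro ω; ring
  simp only [e]
  have hadd : Integrable (fun ω => L t ω ^ 2 + L s ω ^ 2) μ :=
    (hL2 t ht).integrable_sq.add (hL2 s hs).integrable_sq
  rw [integral_sub hadd (hi.const_mul 2),
    integral_add (hL2 t ht).integrable_sq (hL2 s hs).integrable_sq, integral_const_mul,
    cov_eq hAdapted hL2 hMart hs ht hst]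
  ring

lemma m_mono (hAdapted : ∀ t ∈ Set.Ico (0:ℝ) T, StronglyMeasurable[ℱ t] (L t))
    (hL2 : ∀ t ∈ Set.Ico (0:ℝ) T, MemLp (L t) 2 μ)
    (hMart : ∀ s t : ℝ, s ∈ Set.Ico (0:ℝ) T → t ∈ Set.Ico (0:ℝ) T → s ≤ t →
      μ[L t | ℱ s] =ᵐ[μ] L s) :
    MonotoneOn (fun t => ∫ ω, L t ω ^ 2 ∂μ) (Set.Ico 0 T) := by
  intro s hs t ht hst
  have h1 := incr_eq hAdapted hL2 hMart hs ht hst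
  have h2 : 0 ≤ ∫ ω, (L t ω - L s ω) ^ 2 ∂μ := integral_nonneg fun ω => sq_nonneg _
  simp only
  linarith

open Classical in
/-- The process extended by zero outside `[0,T)`. -/
noncomputable def extL (T : ℝ) (L : ℝ → Ω → ℝ) (u : ℝ) (ω : Ω) : ℝ :=
  if u ∈ Set.Ico 0 T then L u ω else 0

lemma extL_of_mem {u : ℝ} (hu : u ∈ Set.Ico 0 T) : extL T L u = L u := by
  funext ω; simp only [extL, if_pos hu]

lemma extL_of_notMem {u : ℝ} (hu : u ∉ Set.Ico 0 T) : extL T L u = fun _ => 0 := by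
  funext ω; simp only [extL, if_neg hu]

lemma extL_meas (hCadlag : ∀ ω, CadlagOn (fun s => L s ω) T)
    (hAdapted : ∀ t ∈ Set.Ico (0:ℝ) T, StronglyMeasurable[ℱ t] (L t)) :
    Measurable (fun p : ℝ × Ω => extL T L p.1 p.2) := by
  apply measurable_of_right_cont
  · intro u
    by_cases hu : u ∈ Set.Ico 0 T
    · rw [extL_of_mem hu]
      exact ((hAdapted u hu).mono (ℱ.le u)).measurable
    · rw [extL_of_notMem hu]
      exact measurable_const
  · intro ω u
    by_cases hu : u ∈ Set.Ico 0 T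
    · rw [extL_of_mem hu]
      have h1 := ((hCadlag ω).1 u hu).mono_left (nhdsWithin_mono u Set.Ioi_subset_Ici_self)
      refine h1.congr' ?_
      filter_upwards [Ioo_mem_nhdsGT hu.2] with s hs
      rw [extL_of_mem ⟨hu.1.trans hs.1.le, hs.2⟩]
    · rw [extL_of_notMem hu]
      refine tendsto_const_nhds.congr' ?_
      by_cases h0 : u < 0
      · filter_upwards [Ioo_mem_nhdsGT h0] with s hs
        rw [extL_of_notMem (fun h => absurd h.1 (not_le.2 hs.2))]
      · have hT : T ≤ u := by
          by_contra h
          exact hu ⟨not_lt.1 h0, not_le.1 h⟩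
        filter_upwards [self_mem_nhdsWithin] with s hs
        rw [extL_of_notMem (fun h => absurd (lt_of_le_of_lt hT hs) (not_lt.2 h.2.le))]

lemma sqFnE_eq (hCadlag : ∀ ω, CadlagOn (fun s => L s ω) T)
    (hAdapted : ∀ t ∈ Set.Ico (0:ℝ) T, StronglyMeasurable[ℱ t] (L t))
    (hL2 : ∀ t ∈ Set.Ico (0:ℝ) T, MemLp (L t) 2 μ)
    (hMart : ∀ s t : ℝ, s ∈ Set.Ico (0:ℝ) T → t ∈ Set.Ico (0:ℝ) T → s ≤ t →
      μ[L t | ℱ s] =ᵐ[μ] L s) (n : ℕ) (t : ℕ → ℝ) (ht : IsTimeNet T n t) :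
    sqFnE μ L n t = ∑ i ∈ Finset.range n, ∫⁻ u in Set.Ioc (t i) (t (i + 1)),
      ENNReal.ofReal (∫ ω, L u ω ^ 2 ∂μ - ∫ ω, L (t i) ω ^ 2 ∂μ) := by
  have hX := extL_meas hCadlag hAdapted
  have ht0 : ∀ i ≤ n, 0 ≤ t i := fun i hi => by
    have := net_mono ht 0 i (Nat.zero_le _) hi; rwa [ht.2.1] at this
  have htT : ∀ i ≤ n, t i ≤ T := fun i hi => by
    have := net_mono ht i n hi le_rfl; rwa [ht.2.2.1] at this
  have htm : ∀ i < n, t i ∈ Set.Ico 0 T := fun i hi =>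
    ⟨ht0 i hi.le, (ht.2.2.2 i hi).trans_le (htT _ hi)⟩
  have hae : ∀ i < n, ∀ᵐ u ∂(volume.restrict (Set.Ioc (t i) (t (i + 1)))),
      u ∈ Set.Ico 0 T ∧ t i ≤ u := by
    intro i hi
    filter_upwards [ae_restrict_mem measurableSet_Ioc,
      ae_restrict_of_ae (Measure.ae_ne volume T)] with u hu hne
    exact ⟨⟨(ht0 i hi.le).trans hu.1.le, lt_of_le_of_ne (hu.2.trans (htT _ hi)) hne⟩, hu.1.le⟩
  have hmeas : ∀ i, Measurable (fun p : Ω × ℝ =>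
      ENNReal.ofReal ((extL T L p.2 p.1 - extL T L (t i) p.1) ^ 2)) := by
    intro i
    have h1 : Measurable (fun p : Ω × ℝ => extL T L p.2 p.1) := hX.comp measurable_swap
    have h2 : Measurable (fun p : Ω × ℝ => extL T L (t i) p.1) :=
      hX.comp (measurable_const.prodMk measurable_fst)
    exact ENNReal.measurable_ofReal.comp ((h1.sub h2).pow_const 2)
  calc sqFnE μ L n t = ∫⁻ ω, (∑ i ∈ Finset.range n, ∫⁻ u in Set.Ioc (t i) (t (i + 1)),
        ENNReal.ofReal ((extL T L u ω - extL T L (t i) ω) ^ 2)) ∂μ := by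
        rw [sqFnE]
        apply lintegral_congr
        intro ω
        apply Finset.sum_congr rfl
        intro i hi
        have hi := Finset.mem_range.1 hi
        apply lintegral_congr_ae
        filter_upwards [hae i hi] with u hu
        rw [extL_of_mem hu.1, extL_of_mem (htm i hi)]
    _ = ∑ i ∈ Finset.range n, ∫⁻ ω, (∫⁻ u in Set.Ioc (t i) (t (i + 1)),
        ENNReal.ofReal ((extL T L u ω - extL T L (t i) ω) ^ 2)) ∂μ := by
        rw [lintegral_finsetSum]
        intro i _
        exact (hmeas i).lintegral_prod_right'
    _ = _ := by
        apply Finset.sum_congr rfl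
        intro i hi
        have hi := Finset.mem_range.1 hi
        rw [lintegral_lintegral_swap (hmeas i).aemeasurable]
        apply lintegral_congr_ae
        filter_upwards [hae i hi] with u hu
        rw [extL_of_mem hu.1, extL_of_mem (htm i hi),
          ← incr_eq hAdapted hL2 hMart (htm i hi) hu.1 hu.2,
          ofReal_integral_eq_lintegral_ofReal]
        · exact ((hL2 u hu.1).sub (hL2 _ (htm i hi))).integrable_sq
        · exact Filter.Eventually.of_forall fun ω => sq_nonneg _

lemma rl_sq (hT : 0 < T) {a : ℝ} (ha : 0 < a) (hCadlag : ∀ ω, CadlagOn (fun s => L s ω) T)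
    (hAdapted : ∀ t ∈ Set.Ico (0:ℝ) T, StronglyMeasurable[ℱ t] (L t))
    (hL2 : ∀ t ∈ Set.Ico (0:ℝ) T, MemLp (L t) 2 μ)
    (hMart : ∀ s t : ℝ, s ∈ Set.Ico (0:ℝ) T → t ∈ Set.Ico (0:ℝ) T → s ≤ t →
      μ[L t | ℱ s] =ᵐ[μ] L s) {t : ℝ} (ht : t ∈ Set.Ico 0 T) :
    ∫⁻ ω, ENNReal.ofReal ((rl T a (fun s => L s ω) t) ^ 2) ∂μ =
      ∫⁻ u, ENNReal.ofReal (∫ ω, L (min u t) ω ^ 2 ∂μ) ∂(nuM T (2 * a)) := by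
  have hX := extL_meas hCadlag hAdapted
  have hp := nuM_prob hT ha
  set ν := nuM T a with hν
  set m : ℝ → ℝ := fun u => ∫ ω, L u ω ^ 2 ∂μ with hm
  have hmm : MonotoneOn m (Set.Ico 0 T) := m_mono hAdapted hL2 hMart
  have hm0 : ∀ u, 0 ≤ m u := fun u => integral_nonneg fun ω => sq_nonneg _
  have hmin : ∀ u ∈ Set.Ioo 0 T, min u t ∈ Set.Ico 0 T := fun u hu =>
    ⟨le_min hu.1.le ht.1, (min_le_right _ _).trans_lt ht.2⟩
  have hmt : ∀ u ∈ Set.Ioo 0 T, m (min u t) ≤ m t := fun u hu =>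
    hmm (hmin u hu) ht (min_le_right _ _)
  set Y : ℝ → Ω → ℝ := fun u => extL T L (min u t) with hY
  have hYm : Measurable (fun p : ℝ × Ω => Y p.1 p.2) :=
    hX.comp ((measurable_fst.min measurable_const).prodMk measurable_snd)
  have hYL : ∀ u ∈ Set.Ioo 0 T, Y u = L (min u t) := fun u hu => extL_of_mem (hmin u hu)
  -- bound on mixed absolute moments
  have habs : ∀ u ∈ Set.Ioo 0 T, ∀ v ∈ Set.Ioo 0 T, ∫ ω, ‖Y u ω * Y v ω‖ ∂μ ≤ m t := by
    intro u hu v hv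
    rw [hYL u hu, hYL v hv]
    have hU := (hL2 _ (hmin u hu)).integrable_sq
    have hV := (hL2 _ (hmin v hv)).integrable_sq
    have hUV : Integrable (fun ω => (L (min u t) ω ^ 2 + L (min v t) ω ^ 2) / 2) μ :=
      (hU.add hV).div_const 2
    calc _ ≤ ∫ ω, (L (min u t) ω ^ 2 + L (min v t) ω ^ 2) / 2 ∂μ := by
          apply integral_mono_of_nonneg (Filter.Eventually.of_forall fun ω => norm_nonneg _)
            hUV
          refine Filter.Eventually.of_forall fun ω => ?_
          simp only [Real.norm_eq_abs, abs_mul]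
          have := sq_nonneg (|L (min u t) ω| - |L (min v t) ω|)
          rw [← sq_abs (L (min u t) ω), ← sq_abs (L (min v t) ω)]
          linarith
      _ = (m (min u t) + m (min v t)) / 2 := by
          rw [integral_div, integral_add hU hV]
      _ ≤ m t := by linarith [hmt u hu, hmt v hv]
  have haeP : ∀ᵐ z ∂(ν.prod ν), z.1 ∈ Set.Ioo 0 T ∧ z.2 ∈ Set.Ioo 0 T := by
    have h1 : ∀ᵐ z ∂(ν.prod ν), z.1 ∈ Set.Ioo 0 T :=
      Measure.quasiMeasurePreserving_fst.ae nuM_ae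
    have h2 : ∀ᵐ z ∂(ν.prod ν), z.2 ∈ Set.Ioo 0 T :=
      Measure.quasiMeasurePreserving_snd.ae nuM_ae
    exact h1.and h2
  have hYint : Integrable (fun p : (ℝ × ℝ) × Ω => Y p.1.1 p.2 * Y p.1.2 p.2) ((ν.prod ν).prod μ) := by
    have hms : Measurable (fun p : (ℝ × ℝ) × Ω => Y p.1.1 p.2 * Y p.1.2 p.2) :=
      (hYm.comp ((measurable_fst.comp measurable_fst).prodMk measurable_snd)).mul
        (hYm.comp ((measurable_snd.comp measurable_fst).prodMk measurable_snd))
    rw [integrable_prod_iff hms.aestronglyMeasurable]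
    constructor
    · filter_upwards [haeP] with z hz
      rw [hYL _ hz.1, hYL _ hz.2]
      exact (hL2 _ (hmin _ hz.1)).integrable_mul (hL2 _ (hmin _ hz.2))
    · apply Integrable.of_bound (C := m t)
      · exact hms.norm.stronglyMeasurable.integral_prod_right'.aestronglyMeasurable
      · filter_upwards [haeP] with z hz
        rw [Real.norm_of_nonneg (integral_nonneg fun ω => norm_nonneg _)]
        exact habs _ hz.1 _ hz.2
  have hmem : ∀ u ∈ Set.Ioc 0 t, u ∈ Set.Ioo 0 T := fun u hu => ⟨hu.1, hu.2.trans_lt ht.2⟩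
  have hYint1 : Integrable (fun p : ℝ × Ω => Y p.1 p.2)
      ((volume.restrict (Set.Ioc 0 t)).prod μ) := by
    rw [integrable_prod_iff hYm.aestronglyMeasurable]
    constructor
    · filter_upwards [ae_restrict_mem measurableSet_Ioc] with u hu
      rw [hYL u (hmem u hu)]
      exact (hL2 _ (hmin u (hmem u hu))).integrable (by norm_num)
    · apply Integrable.of_bound (C := 1 + m t)
      · exact hYm.norm.stronglyMeasurable.integral_prod_right'.aestronglyMeasurable
      · filter_upwards [ae_restrict_mem measurableSet_Ioc] with u hu
        rw [Real.norm_of_nonneg (integral_nonneg fun ω => norm_nonneg _)]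
        rw [hYL u (hmem u hu)]
        have hU := (hL2 _ (hmin u (hmem u hu))).integrable_sq
        have hU1 : Integrable (fun ω => 1 + L (min u t) ω ^ 2) μ := (integrable_const 1).add hU
        calc _ ≤ ∫ ω, (1 + L (min u t) ω ^ 2) ∂μ := by
              apply integral_mono_of_nonneg (Filter.Eventually.of_forall fun ω => norm_nonneg _)
                hU1
              refine Filter.Eventually.of_forall fun ω => ?_
              simp only [Real.norm_eq_abs]
              rw [← sq_abs (L (min u t) ω)]
              nlinarith [sq_nonneg (|L (min u t) ω| - 1), abs_nonneg (L (min u t) ω)]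
          _ = 1 + m (min u t) := by
              rw [integral_add (integrable_const 1) hU]; simp [hm]
          _ ≤ 1 + m t := by linarith [hmt u (hmem u hu)]
  have hrl : ∀ᵐ ω ∂μ, (rl T a (fun s => L s ω) t) ^ 2 =
      ∫ z, Y z.1 ω * Y z.2 ω ∂(ν.prod ν) := by
    filter_upwards [hYint1.prod_left_ae] with ω hω
    have hK : IntegrableOn (fun s => L s ω) (Set.Ioc 0 t) := by
      refine Integrable.congr hω ?_
      filter_upwards [ae_restrict_mem measurableSet_Ioc] with u hu
      rw [hYL u (hmem u hu), min_eq_left hu.2]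
    rw [rl_eq hT ha ht _ hK, integral_prod_mul (fun u => Y u ω) (fun u => Y u ω), sq]
    have : ∫ u, L (min u t) ω ∂ν = ∫ u, Y u ω ∂ν := by
      apply integral_congr_ae
      filter_upwards [nuM_ae] with u hu
      rw [hYL u hu]
    rw [← hν, this]
  have hp2 := nuM_prob hT (show 0 < 2 * a by positivity)
  have hmint : Integrable (fun w => m (min w t)) (nuM T (2 * a)) := by
    have hmeas : AEStronglyMeasurable (fun w => m (min w t)) (nuM T (2 * a)) := by
      have h := (aemeas_min (T := T) (a := 2 * a) ht.1 m hmm).ennreal_toReal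
      refine (h.congr ?_).aestronglyMeasurable
      exact Filter.Eventually.of_forall fun w => ENNReal.toReal_ofReal (hm0 _)
    apply Integrable.of_bound hmeas (m t)
    filter_upwards [nuM_ae] with u hu
    rw [Real.norm_of_nonneg (hm0 _)]
    exact hmt u hu
  calc ∫⁻ ω, ENNReal.ofReal ((rl T a (fun s => L s ω) t) ^ 2) ∂μ
      = ∫⁻ ω, ENNReal.ofReal (∫ z, Y z.1 ω * Y z.2 ω ∂(ν.prod ν)) ∂μ := by
        apply lintegral_congr_ae
        filter_upwards [hrl] with ω hω
        rw [hω]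
    _ = ENNReal.ofReal (∫ ω, ∫ z, Y z.1 ω * Y z.2 ω ∂(ν.prod ν) ∂μ) := by
        rw [ofReal_integral_eq_lintegral_ofReal]
        · exact hYint.integral_prod_right
        · filter_upwards [hrl] with ω hω
          rw [← hω]
          exact sq_nonneg _
    _ = ENNReal.ofReal (∫ z, ∫ ω, Y z.1 ω * Y z.2 ω ∂μ ∂(ν.prod ν)) := by
        rw [integral_integral_swap (f := fun ω (z : ℝ × ℝ) => Y z.1 ω * Y z.2 ω) hYint.swap]
    _ = ENNReal.ofReal (∫ z, m (min (min z.1 z.2) t) ∂(ν.prod ν)) := by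
        congr 1
        apply integral_congr_ae
        filter_upwards [haeP] with z hz
        rw [hYL _ hz.1, hYL _ hz.2, cov_min hAdapted hL2 hMart (hmin _ hz.1) (hmin _ hz.2)]
        have : min (min z.1 t) (min z.2 t) = min (min z.1 z.2) t := by
          rw [min_min_min_comm, min_self]
        rw [this]
    _ = ENNReal.ofReal (∫ w, m (min w t) ∂(nuM T (2 * a))) := by
        rw [← nuM_map_min hT ha, integral_map (measurable_fst.min measurable_snd).aemeasurable]
        rw [nuM_map_min hT ha]
        exact hmint.aestronglyMeasurable
    _ = _ := by
        rw [ofReal_integral_eq_lintegral_ofReal hmint]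
        exact Filter.Eventually.of_forall fun w => hm0 _

end prob

/-- For a càdlàg `L_2`-martingale `L = (L_t)_{t∈[0,T)}` and `θ ∈ (0,1)`, `α := (1−θ)/2`,
the following are equivalent:
(i) `(I_t^α L)_{t∈[0,T)}` is bounded in `L_2`, i.e. `sup_{t∈[0,T)} E|I_t^α L|² < ∞`;
(ii) there is a `c > 0` with `E [L;τ]_T ≤ c ‖τ‖_θ` for all deterministic time nets `τ`;
(iii) `∫_0^T (T−t)^{−θ} E[L_t²] dt < ∞`. -/
theorem rl_L2_interpolation
    {Ω : Type*} {mΩ : MeasurableSpace Ω} {μ : Measure Ω} [IsProbabilityMeasure μ]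
    (ℱ : Filtration ℝ mΩ) (T : ℝ) (hT : 0 < T)
    (hComplete : ∀ s : ℝ, ∀ A : Set Ω, μ A = 0 → MeasurableSet[ℱ s] A)
    (hRight : ∀ s : ℝ, (ℱ s : MeasurableSpace Ω) = ⨅ u ∈ Set.Ioi s, (ℱ u : MeasurableSpace Ω))
    (θ : ℝ) (hθ : θ ∈ Set.Ioo (0:ℝ) 1)
    (L : ℝ → Ω → ℝ)
    (hCadlag : ∀ ω, CadlagOn (fun s => L s ω) T)
    (hAdapted : ∀ t ∈ Set.Ico (0:ℝ) T, StronglyMeasurable[ℱ t] (L t))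
    (hL2 : ∀ t ∈ Set.Ico (0:ℝ) T, MemLp (L t) 2 μ)
    (hMart : ∀ s t : ℝ, s ∈ Set.Ico (0:ℝ) T → t ∈ Set.Ico (0:ℝ) T → s ≤ t →
      μ[L t | ℱ s] =ᵐ[μ] L s) :
    ((⨆ t ∈ Set.Ico (0:ℝ) T,
        ∫⁻ ω, ENNReal.ofReal ((rl T ((1 - θ) / 2) (fun s => L s ω) t) ^ 2) ∂μ) < ⊤ ↔
      (∃ c : ℝ, 0 < c ∧ ∀ (n : ℕ) (t : ℕ → ℝ), IsTimeNet T n t →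
        sqFnE μ L n t ≤ ENNReal.ofReal (c * meshTheta T θ n t))) ∧
    ((⨆ t ∈ Set.Ico (0:ℝ) T,
        ∫⁻ ω, ENNReal.ofReal ((rl T ((1 - θ) / 2) (fun s => L s ω) t) ^ 2) ∂μ) < ⊤ ↔
      (∫⁻ t in Set.Ioo (0:ℝ) T,
        ENNReal.ofReal ((T - t) ^ (-θ)) * ∫⁻ ω, ENNReal.ofReal ((L t ω) ^ 2) ∂μ) < ⊤) := by
  set m : ℝ → ℝ := fun t => ∫ ω, L t ω ^ 2 ∂μ with hmdef
  have hm : MonotoneOn m (Set.Ico 0 T) := m_mono hAdapted hL2 hMart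
  have hm0 : ∀ u, 0 ≤ m u := fun u => integral_nonneg fun ω => sq_nonneg _
  have hα : 0 < (1 - θ) / 2 := by linarith [hθ.2]
  have hrl : ∀ t ∈ Set.Ico (0:ℝ) T,
      ∫⁻ ω, ENNReal.ofReal ((rl T ((1 - θ) / 2) (fun s => L s ω) t) ^ 2) ∂μ =
        ∫⁻ u, ENNReal.ofReal (m (min u t)) ∂(nuM T (1 - θ)) := by
    intro t ht
    rw [rl_sq hT hα hCadlag hAdapted hL2 hMart ht, mul_div_cancel₀ _ (two_ne_zero)]
  have h1 : (⨆ t ∈ Set.Ico (0:ℝ) T,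
        ∫⁻ ω, ENNReal.ofReal ((rl T ((1 - θ) / 2) (fun s => L s ω) t) ^ 2) ∂μ) < ⊤ ↔
      ∫⁻ u, ENNReal.ofReal (m u) ∂(nuM T (1 - θ)) < ⊤ := by
    constructor
    · intro h
      refine lt_of_le_of_lt (W_le hT m hm _ ?_) h
      intro b hb
      rw [← hrl b hb]
      exact le_iSup₂ (f := fun t (_ : t ∈ Set.Ico (0:ℝ) T) =>
        ∫⁻ ω, ENNReal.ofReal ((rl T ((1 - θ) / 2) (fun s => L s ω) t) ^ 2) ∂μ) b hb
    · intro h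
      refine lt_of_le_of_lt (iSup₂_le ?_) h
      intro b hb
      rw [hrl b hb]
      exact min_le_W hb m hm
  have h2 : (∃ c : ℝ, 0 < c ∧ ∀ (n : ℕ) (t : ℕ → ℝ), IsTimeNet T n t →
        sqFnE μ L n t ≤ ENNReal.ofReal (c * meshTheta T θ n t)) ↔
      ∫⁻ u, ENNReal.ofReal (m u) ∂(nuM T (1 - θ)) < ⊤ := by
    rw [← ii_iff hT hθ m hm0 hm]
    refine exists_congr fun c => and_congr_right fun _ => forall_congr' fun n =>
      forall_congr' fun t => forall_congr' fun ht => ?_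
    rw [sqFnE_eq hCadlag hAdapted hL2 hMart n t ht]
  have h3 : (∫⁻ t in Set.Ioo (0:ℝ) T,
        ENNReal.ofReal ((T - t) ^ (-θ)) * ∫⁻ ω, ENNReal.ofReal ((L t ω) ^ 2) ∂μ) < ⊤ ↔
      ∫⁻ u, ENNReal.ofReal (m u) ∂(nuM T (1 - θ)) < ⊤ := by
    rw [iii_iff hT hθ (fun t => ∫⁻ ω, ENNReal.ofReal ((L t ω) ^ 2) ∂μ)]
    have : ∫⁻ u, (∫⁻ ω, ENNReal.ofReal ((L u ω) ^ 2) ∂μ) ∂(nuM T (1 - θ)) =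
        ∫⁻ u, ENNReal.ofReal (m u) ∂(nuM T (1 - θ)) := by
      apply lintegral_congr_ae
      filter_upwards [nuM_ae] with u hu
      rw [hmdef, ofReal_integral_eq_lintegral_ofReal]
      · exact (hL2 u ⟨hu.1.le, hu.2⟩).integrable_sq
      · exact Filter.Eventually.of_forall fun ω => sq_nonneg _
    rw [this]
  exact ⟨h1.trans h2.symm, h1.trans h3.symm⟩
end

section
/- Let T>0, let (Ω,F,P,(F_t)_{t∈[0,T]}) be a complete filtered probability space satisfying the usual conditions, let α>0, and let L=(L_t)_{t∈[0,T)} be a càdlàg martingale with L_t∈L_2 for all t. Then for all 0≤a<t<T one has, almost surely, E[|I_t^α L − I_a^α L|² | F_a] = 2α E[∫_a^T |L_{u∧t} − L_a|² ((T−u)/T)^{2α−1} du/T | F_a], and moreover E[|I_t^α L − I_a^α L|² | F_a] + ((T−a)/T)^{2α} L_a² = 2α E[∫_a^T |L_{u∧t}|² ((T−u)/T)^{2α−1} du/T | F_a] almost surely. -/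
open MeasureTheory Filter Set ENNReal

theorem rl_jointMeas {Ω : Type*} [MeasurableSpace Ω] (P : ℝ → Ω → ℝ) (hm : ∀ u, Measurable (P u))
    (hr : ∀ ω u, ContinuousWithinAt (fun u => P u ω) (Ici u) u) :
    Measurable (fun p : ℝ × Ω => P p.1 p.2) := by
  refine measurable_of_tendsto_metrizable
    (f := fun (n : ℕ) (p : ℝ × Ω) => P (((⌊((n:ℝ)+1) * p.1⌋ : ℝ) + 1) / ((n:ℝ)+1)) p.2) ?_ ?_
  · intro n
    have h1 : Measurable (fun q : ℤ × Ω => P (((q.1 : ℝ) + 1) / ((n:ℝ)+1)) q.2) :=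
      measurable_from_prod_countable_right (fun k => hm (((k : ℝ) + 1) / ((n:ℝ)+1)))
    have h2 : Measurable (fun p : ℝ × Ω => ((⌊((n:ℝ)+1) * p.1⌋ : ℤ), p.2)) :=
      (Int.measurable_floor.comp (measurable_fst.const_mul _)).prodMk measurable_snd
    exact h1.comp h2
  · rw [tendsto_pi_nhds]
    rintro ⟨u, ω⟩
    refine (hr ω u).tendsto.comp ?_
    refine tendsto_nhdsWithin_iff.2 ⟨?_, Eventually.of_forall fun n => ?_⟩
    · have h0 : Tendsto (fun n : ℕ => u + 1 / ((n:ℝ) + 1)) atTop (nhds (u + 0)) :=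
        tendsto_const_nhds.add tendsto_one_div_add_atTop_nhds_zero_nat
      rw [add_zero] at h0
      refine tendsto_of_tendsto_of_tendsto_of_le_of_le tendsto_const_nhds h0 ?_ ?_
      · intro n
        have hp : (0:ℝ) < (n:ℝ) + 1 := by positivity
        have := Int.lt_floor_add_one (((n:ℝ)+1) * u)
        show u ≤ _ / _
        rw [le_div_iff₀ hp]; linarith
      · intro n
        have hp : (0:ℝ) < (n:ℝ) + 1 := by positivity
        have := Int.floor_le (((n:ℝ)+1) * u)
        show _ / _ ≤ u + 1 / _
        rw [div_le_iff₀ hp, add_mul u, div_mul_cancel₀ _ hp.ne']; linarith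
    · have hp : (0:ℝ) < (n:ℝ) + 1 := by positivity
      have := Int.lt_floor_add_one (((n:ℝ)+1) * u)
      show u ≤ _ / _
      rw [le_div_iff₀ hp]; linarith

theorem rl_sqInt {Ω : Type*} [MeasurableSpace Ω] {μ : Measure Ω} [IsFiniteMeasure μ]
    {ν : Measure ℝ} [IsFiniteMeasure ν] (N : ℝ → Ω → ℝ)
    (hm : Measurable (fun p : ℝ × Ω => N p.1 p.2)) (C : ℝ)
    (hi : ∀ u, Integrable (fun ω => (N u ω) ^ 2) μ) (hC : ∀ u, ∫ ω, (N u ω) ^ 2 ∂μ ≤ C) :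
    Integrable (fun p : ℝ × Ω => (N p.1 p.2) ^ 2) (ν.prod μ) := by
  have hs : StronglyMeasurable (fun p : ℝ × Ω => (N p.1 p.2) ^ 2) := (hm.pow_const 2).stronglyMeasurable
  rw [integrable_prod_iff hs.aestronglyMeasurable]
  refine ⟨Eventually.of_forall hi, ?_⟩
  refine Integrable.of_bound (C := C) ?_ (Eventually.of_forall fun u => ?_)
  · exact (hs.norm.integral_prod_right').aestronglyMeasurable
  · have : ∀ ω, ‖(N u ω) ^ 2‖ = (N u ω) ^ 2 := fun ω => by
      rw [Real.norm_eq_abs, abs_of_nonneg (sq_nonneg _)]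
    simp only [this]
    rw [Real.norm_eq_abs, abs_of_nonneg (integral_nonneg fun ω => sq_nonneg _)]
    exact hC u

/-- Abstract isometry. -/
theorem rl_abstract {Ω : Type*} [MeasurableSpace Ω] {μ : Measure Ω} [IsFiniteMeasure μ]
    {ν : Measure ℝ} [IsFiniteMeasure ν] [NullSingletonClass ν] (N : ℝ → Ω → ℝ)
    (hm : Measurable (fun p : ℝ × Ω => N p.1 p.2)) (C : ℝ)
    (hi : ∀ u, Integrable (fun ω => (N u ω) ^ 2) μ) (hC : ∀ u, ∫ ω, (N u ω) ^ 2 ∂μ ≤ C)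
    (hN : ∀ u v, u ≤ v → ∫ ω, N u ω * N v ω ∂μ = ∫ ω, (N u ω) ^ 2 ∂μ) :
    Integrable (fun ω => (∫ u, N u ω ∂ν) ^ 2) μ ∧
    Integrable (fun ω => ∫ u, (N u ω) ^ 2 * ν.real (Ioi u) ∂ν) μ ∧
    Integrable (fun u => (∫ ω, (N u ω) ^ 2 ∂μ) * ν.real (Ioi u)) ν ∧
    ∫ ω, (∫ u, N u ω ∂ν) ^ 2 ∂μ = 2 * ∫ u, (∫ ω, (N u ω) ^ 2 ∂μ) * ν.real (Ioi u) ∂ν ∧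
    ∫ ω, (∫ u, (N u ω) ^ 2 * ν.real (Ioi u) ∂ν) ∂μ
      = ∫ u, (∫ ω, (N u ω) ^ 2 ∂μ) * ν.real (Ioi u) ∂ν := by
  have hsq := rl_sqInt (ν := ν) N hm C hi hC
  have hV : Measurable (fun u : ℝ => ν.real (Ioi u)) := by
    have : Antitone (fun u : ℝ => ν.real (Ioi u)) := fun x y h =>
      measureReal_mono (Ioi_subset_Ioi h)
    exact this.measurable
  have hsqV : Integrable (fun p : ℝ × Ω => (N p.1 p.2) ^ 2 * ν.real (Ioi p.1)) (ν.prod μ) := by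
    refine hsq.mul_bdd (c := ν.real univ) (hV.comp measurable_fst).aestronglyMeasurable ?_
    refine Eventually.of_forall fun p => ?_
    rw [Real.norm_eq_abs, abs_of_nonneg measureReal_nonneg]
    exact measureReal_mono (subset_univ _)
  have hprod : Integrable (fun q : (ℝ × ℝ) × Ω => N q.1.1 q.2 * N q.1.2 q.2) ((ν.prod ν).prod μ) := by
    have e1 := rl_sqInt (μ := μ) (ν := ν) N hm C hi hC
    have m1 : Measurable (fun q : (ℝ × ℝ) × Ω => N q.1.1 q.2) :=
      hm.comp ((measurable_fst.comp measurable_fst).prodMk measurable_snd)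
    have m2 : Measurable (fun q : (ℝ × ℝ) × Ω => N q.1.2 q.2) :=
      hm.comp ((measurable_snd.comp measurable_fst).prodMk measurable_snd)
    have hK : ∀ u v, Integrable (fun ω => N u ω * N v ω) μ := by
      intro u v
      have n1 : ∀ u, Measurable (N u) := fun u => hm.comp (measurable_const.prodMk measurable_id)
      refine ((hi u).add (hi v)).mono' ((n1 u).mul (n1 v)).aestronglyMeasurable
        (Eventually.of_forall fun ω => ?_)
      simp only [Real.norm_eq_abs, Pi.add_apply]
      rw [abs_le]; constructor <;> nlinarith [sq_nonneg (N u ω - N v ω), sq_nonneg (N u ω + N v ω)]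
    have m12 : Measurable (fun q : (ℝ × ℝ) × Ω => N q.1.1 q.2 * N q.1.2 q.2) := m1.mul m2
    rw [integrable_prod_iff m12.aestronglyMeasurable]
    refine ⟨Eventually.of_forall fun p => hK p.1 p.2, ?_⟩
    refine Integrable.of_bound (C := C + C) 
      (m12.stronglyMeasurable.norm.integral_prod_right').aestronglyMeasurable
      (Eventually.of_forall fun p => ?_)
    rw [Real.norm_eq_abs, abs_of_nonneg (integral_nonneg fun ω => norm_nonneg _)]
    calc ∫ ω, ‖N p.1 ω * N p.2 ω‖ ∂μ ≤ ∫ ω, ((N p.1 ω) ^ 2 + (N p.2 ω) ^ 2) ∂μ := by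
          refine integral_mono (hK _ _).norm ((hi _).add (hi _)) fun ω => ?_
          simp only [Real.norm_eq_abs]
          rw [abs_le]
          constructor <;> nlinarith [sq_nonneg (N p.1 ω - N p.2 ω), sq_nonneg (N p.1 ω + N p.2 ω)]
      _ = _ := integral_add (hi _) (hi _)
      _ ≤ C + C := add_le_add (hC _) (hC _)
  have hsqr : ∀ ω, (∫ u, N u ω ∂ν) ^ 2 = ∫ p : ℝ × ℝ, N p.1 ω * N p.2 ω ∂(ν.prod ν) := by
    intro ω
    rw [integral_prod_mul (fun u => N u ω) (fun u => N u ω), sq]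
  set g : ℝ → ℝ := fun u => ∫ ω, (N u ω) ^ 2 ∂μ with hg
  have hgm : StronglyMeasurable g :=
    ((hm.pow_const 2).stronglyMeasurable).integral_prod_right'
  have hgb : ∀ u, ‖g u‖ ≤ C := fun u => by
    rw [Real.norm_eq_abs, abs_of_nonneg (integral_nonneg fun ω => sq_nonneg _)]
    exact hC u
  have hmin : ∀ u v, ∫ ω, N u ω * N v ω ∂μ = g (min u v) := by
    intro u v
    rcases le_total u v with h | h
    · rw [min_eq_left h]; exact hN u v h
    · rw [min_eq_right h]; simp_rw [mul_comm (N u _)]; exact hN v u h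
  refine ⟨?_, hsqV.integral_prod_right, ?_, ?_, ?_⟩
  · simp_rw [hsqr]; exact hprod.integral_prod_right
  · have := hsqV.integral_prod_left
    simpa only [integral_mul_const] using this
  · simp_rw [hsqr]
    rw [integral_integral_swap (f := fun ω (p : ℝ × ℝ) => N p.1 ω * N p.2 ω) hprod.swap]
    simp_rw [hmin]
    have hint : ∀ s : Set (ℝ × ℝ), MeasurableSet s → ∀ f : ℝ × ℝ → ℝ, Measurable f →
        Integrable (s.indicator fun p => g (f p)) (ν.prod ν) := by
      intro s hs f hf
      refine Integrable.indicator ?_ hs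
      exact Integrable.of_bound (hgm.measurable.comp hf).aestronglyMeasurable C
        (Eventually.of_forall fun p => hgb _)
    have hs1 : MeasurableSet {p : ℝ × ℝ | p.1 < p.2} := measurableSet_lt measurable_fst measurable_snd
    have hs2 : MeasurableSet {p : ℝ × ℝ | p.2 < p.1} := measurableSet_lt measurable_snd measurable_fst
    have hI : ∫ p, ({p : ℝ × ℝ | p.1 < p.2}.indicator fun p => g p.1) p ∂(ν.prod ν)
        = ∫ u, g u * ν.real (Ioi u) ∂ν := by
      rw [integral_prod _ (hint _ hs1 _ measurable_fst)]
      congr 1; ext u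
      have : ∀ v, ({p : ℝ × ℝ | p.1 < p.2}.indicator fun p => g p.1) (u, v)
          = (Ioi u).indicator (fun _ => g u) v := by
        intro v; simp [indicator]
      simp_rw [this]
      rw [integral_indicator measurableSet_Ioi]
      simp [mul_comm]
    have hJ : ∫ p, ({p : ℝ × ℝ | p.2 < p.1}.indicator fun p => g p.2) p ∂(ν.prod ν)
        = ∫ u, g u * ν.real (Ioi u) ∂ν := by
      rw [← hI, ← integral_prod_swap]
      rfl
    have hdiag : ∀ᵐ p ∂(ν.prod ν), p.1 ≠ p.2 := by
      have hd : MeasurableSet {p : ℝ × ℝ | p.1 ≠ p.2} :=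
        (measurableSet_eq_fun measurable_fst measurable_snd).compl
      rw [Measure.ae_prod_iff_ae_ae hd]
      refine Eventually.of_forall fun u => ?_
      rw [ae_iff]
      simp
    rw [two_mul]
    nth_rewrite 1 [← hI]
    rw [← hJ, ← integral_add (hint _ hs1 _ measurable_fst) (hint _ hs2 _ measurable_snd)]
    refine integral_congr_ae ?_
    filter_upwards [hdiag] with p hp
    rcases lt_or_gt_of_ne hp with h | h
    · simp [indicator, h, h.le, not_lt.2 h.le]
    · simp [indicator, h, h.le, not_lt.2 h.le]
  · rw [integral_integral_swap (f := fun ω u => (N u ω) ^ 2 * ν.real (Ioi u)) hsqV.swap]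
    simp_rw [integral_mul_const]

theorem rl_mart {Ω : Type*} {mΩ : MeasurableSpace Ω} {μ : Measure Ω} [IsProbabilityMeasure μ]
    (ℱ : Filtration ℝ mΩ) (T : ℝ) 
    (L : ℝ → Ω → ℝ)
    (hAdapted : ∀ t ∈ Set.Ico (0:ℝ) T, StronglyMeasurable[ℱ t] (L t))
    (hL2 : ∀ t ∈ Set.Ico (0:ℝ) T, MemLp (L t) 2 μ)
    (hMart : ∀ s t : ℝ, s ∈ Set.Ico (0:ℝ) T → t ∈ Set.Ico (0:ℝ) T → s ≤ t →
      μ[L t | ℱ s] =ᵐ[μ] L s) (u v : ℝ) (hu : 0 ≤ u) (huv : u ≤ v) (hv : v < T)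
    (A : Set Ω) (hA : MeasurableSet[ℱ u] A) :
    ∫ ω in A, L u ω * L v ω ∂μ = ∫ ω in A, (L u ω) ^ 2 ∂μ := by
  have hum : u ∈ Ico (0:ℝ) T := ⟨hu, huv.trans_lt hv⟩
  have hvm : v ∈ Ico (0:ℝ) T := ⟨hu.trans huv, hv⟩
  have hint : Integrable (L u * L v) μ := (hL2 u hum).integrable_mul (hL2 v hvm)
  have h1 := condExp_mul_of_stronglyMeasurable_left (hAdapted u hum) hint
    ((hL2 v hvm).integrable (by norm_num))
  have h2 := setIntegral_condExp (ℱ.le u) hint hA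
  change ∫ ω in A, (L u * L v) ω ∂μ = _
  rw [← h2]
  refine integral_congr_ae (ae_restrict_of_ae ?_)
  filter_upwards [h1, hMart u v hum hvm huv] with ω e1 e2
  rw [e1, Pi.mul_apply, e2, sq]

theorem rl_weight (T α : ℝ) (hT : 0 < T) (hα : 0 < α) (c : ℝ) (hc : c ≤ T) :
    ∫ u in c..T, α / T ^ α * (T - u) ^ (α - 1) = ((T - c) / T) ^ α := by
  rw [intervalIntegral.integral_const_mul,
    intervalIntegral.integral_comp_sub_left (fun x => x ^ (α - 1)) T,
    integral_rpow (Or.inl (by linarith)), sub_self, sub_add_cancel, Real.zero_rpow hα.ne',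
    Real.div_rpow (by linarith) hT.le]
  field_simp
  ring

theorem rl_weight_int (T α : ℝ) (hα : 0 < α) (b c : ℝ) :
    IntervalIntegrable (fun u => α / T ^ α * (T - u) ^ (α - 1)) volume b c := by
  refine IntervalIntegrable.const_mul ?_ _
  have := (intervalIntegral.intervalIntegrable_rpow' (a := T - b) (b := T - c)
    (r := α - 1) (by linarith)).comp_sub_left T
  simpa using this

theorem rl_nu (T α : ℝ) (hT : 0 < T) (hα : 0 < α) (a : ℝ) (ha : a < T) :
    ∃ ν : Measure ℝ, IsFiniteMeasure ν ∧ NullSingletonClass ν ∧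
      (∀ f : ℝ → ℝ, ∫ u, f u ∂ν = ∫ u in a..T, α / T ^ α * (T - u) ^ (α - 1) * f u) ∧
      (∀ u ∈ Ico a T, ν.real (Ioi u) = ((T - u) / T) ^ α) := by
  have hwm : Measurable (fun u => ENNReal.ofReal (α / T ^ α * (T - u) ^ (α - 1))) := by fun_prop
  have hwi : ∀ b, b ≤ T → IntegrableOn (fun u => α / T ^ α * (T - u) ^ (α - 1)) (Ioo b T) volume := by
    intro b hb
    exact ((intervalIntegrable_iff_integrableOn_Ioo_of_le hb).1 (rl_weight_int T α hα b T))
  have hw0 : ∀ u, u < T → 0 ≤ α / T ^ α * (T - u) ^ (α - 1) := fun u hu => by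
    have : 0 < T - u := by linarith
    positivity
  have hae : ∀ b, ∀ᵐ u ∂(volume.restrict (Ioo b T)), 0 ≤ α / T ^ α * (T - u) ^ (α - 1) := by
    intro b
    filter_upwards [ae_restrict_mem measurableSet_Ioo] with u hu using hw0 u hu.2
  refine ⟨(volume.restrict (Ioo a T)).withDensity
    (fun u => ENNReal.ofReal (α / T ^ α * (T - u) ^ (α - 1))), ?_, ?_, ?_, ?_⟩
  · exact isFiniteMeasure_withDensity_ofReal (hwi a ha.le).2
  · infer_instance
  · intro f
    rw [integral_withDensity_eq_integral_toReal_smul hwm (by simp),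
      intervalIntegral.integral_of_le ha.le, integral_Ioc_eq_integral_Ioo]
    refine integral_congr_ae ?_
    filter_upwards [hae a] with u hu
    rw [ENNReal.toReal_ofReal hu, smul_eq_mul]
  · intro u hu
    rw [measureReal_def, withDensity_apply _ measurableSet_Ioi, Measure.restrict_restrict measurableSet_Ioi]
    have : Ioi u ∩ Ioo a T = Ioo u T := by
      ext x; simp only [mem_inter_iff, mem_Ioi, mem_Ioo]
      exact ⟨fun h => ⟨h.1, h.2.2⟩, fun h => ⟨h.1, hu.1.trans_lt h.1, h.2⟩⟩
    rw [this, ← ofReal_integral_eq_lintegral_ofReal (hwi u hu.2.le) (hae u),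
      ENNReal.toReal_ofReal (integral_nonneg_of_ae (hae u)), ← integral_Ioc_eq_integral_Ioo,
      ← intervalIntegral.integral_of_le hu.2.le, rl_weight T α hT hα u hu.2.le]

theorem rl_path (T α : ℝ) (hT : 0 < T) (hα : 0 < α) (a t : ℝ) (ha : 0 ≤ a) (hat : a < t) (htT : t < T)
    (K : ℝ → ℝ) (hK : IntervalIntegrable (fun u => (T - u) ^ (α - 1) * K u) volume 0 t) :
    rl T α K t - rl T α K a
      = ∫ u in a..T, α / T ^ α * (T - u) ^ (α - 1) * (K (max a (min u t)) - K a) := by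
  have hK1 : IntervalIntegrable (fun u => (T - u) ^ (α - 1) * K u) volume 0 a :=
    hK.mono_set (by rw [uIcc_of_le ha, uIcc_of_le (ha.trans hat.le)]; exact Icc_subset_Icc_right hat.le)
  have hK2 : IntervalIntegrable (fun u => (T - u) ^ (α - 1) * K u) volume a t :=
    hK.mono_set (by rw [uIcc_of_le hat.le, uIcc_of_le (ha.trans hat.le)]; exact Icc_subset_Icc_left ha)
  have e1 : EqOn (fun u => α / T ^ α * ((T - u) ^ (α - 1) * K u) - α / T ^ α * (T - u) ^ (α - 1) * K a)
      (fun u => α / T ^ α * (T - u) ^ (α - 1) * (K (max a (min u t)) - K a)) (uIcc a t) := by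
    intro u hu
    rw [uIcc_of_le hat.le] at hu
    simp only [min_eq_left hu.2, max_eq_right hu.1]
    ring
  have e2 : EqOn (fun u => α / T ^ α * (T - u) ^ (α - 1) * (K t - K a))
      (fun u => α / T ^ α * (T - u) ^ (α - 1) * (K (max a (min u t)) - K a)) (uIcc t T) := by
    intro u hu
    rw [uIcc_of_le htT.le] at hu
    simp only [min_eq_right hu.1, max_eq_right hat.le]
  have i1a := hK2.const_mul (α / T ^ α)
  have i1b := (rl_weight_int T α hα a t).mul_const (K a)
  have i2 := (rl_weight_int T α hα t T).mul_const (K t - K a)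
  have w3 := intervalIntegral.integral_add_adjacent_intervals (rl_weight_int T α hα a t)
    (rl_weight_int T α hα t T)
  rw [rl_weight T α hT hα t htT.le, rl_weight T α hT hα a (hat.trans htT).le] at w3
  have k3 := intervalIntegral.integral_add_adjacent_intervals hK1 hK2
  rw [← intervalIntegral.integral_add_adjacent_intervals
    ((i1a.sub i1b).congr (e1.mono uIoc_subset_uIcc)) (i2.congr (e2.mono uIoc_subset_uIcc)),
    ← intervalIntegral.integral_congr e1, ← intervalIntegral.integral_congr e2,
    intervalIntegral.integral_sub i1a i1b, intervalIntegral.integral_const_mul,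
    intervalIntegral.integral_mul_const, intervalIntegral.integral_mul_const,
    rl_weight T α hT hα t htT.le]
  unfold rl
  rw [← k3]
  linear_combination (K a) * w3

theorem rl_clamp_rc {K : ℝ → ℝ} {T a t : ℝ} (hK : CadlagOn K T) (ha : 0 ≤ a) (hat : a ≤ t) (htT : t < T)
    (u : ℝ) : ContinuousWithinAt (fun u => K (max a (min u t))) (Ici u) u := by
  have h := hK.1 (max a (min u t)) ⟨ha.trans (le_max_left _ _),
    (max_le hat (min_le_right _ _)).trans_lt htT⟩
  refine Tendsto.comp h ?_
  refine tendsto_nhdsWithin_iff.2 ⟨?_, ?_⟩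
  · have : Continuous (fun u : ℝ => max a (min u t)) := by fun_prop
    exact this.continuousAt.continuousWithinAt
  · filter_upwards [self_mem_nhdsWithin] with x hx
    exact max_le_max le_rfl (min_le_min (mem_Ici.1 hx) le_rfl)

theorem rl_martingale_conditional_identities
    {Ω : Type*} {mΩ : MeasurableSpace Ω} {μ : Measure Ω} [IsProbabilityMeasure μ]
    (ℱ : Filtration ℝ mΩ) (T : ℝ) (hT : 0 < T)
    (hComplete : ∀ s : ℝ, ∀ A : Set Ω, μ A = 0 → MeasurableSet[ℱ s] A)
    (hRight : ∀ s : ℝ, (ℱ s : MeasurableSpace Ω) = ⨅ u ∈ Set.Ioi s, (ℱ u : MeasurableSpace Ω))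
    (α : ℝ) (hα : 0 < α)
    (L : ℝ → Ω → ℝ)
    (hCadlag : ∀ ω, CadlagOn (fun s => L s ω) T)
    (hAdapted : ∀ t ∈ Set.Ico (0:ℝ) T, StronglyMeasurable[ℱ t] (L t))
    (hL2 : ∀ t ∈ Set.Ico (0:ℝ) T, MemLp (L t) 2 μ)
    (hMart : ∀ s t : ℝ, s ∈ Set.Ico (0:ℝ) T → t ∈ Set.Ico (0:ℝ) T → s ≤ t →
      μ[L t | ℱ s] =ᵐ[μ] L s) :
    ∀ a t : ℝ, 0 ≤ a → a < t → t < T →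
      ∀ A : Set Ω, MeasurableSet[ℱ a] A →
        ((∫⁻ ω in A, ENNReal.ofReal
            ((rl T α (fun s => L s ω) t - rl T α (fun s => L s ω) a) ^ 2) ∂μ)
          = ∫⁻ ω in A, ENNReal.ofReal (2 * α *
              ∫ u in a..T, (L (min u t) ω - L a ω) ^ 2 * ((T - u) / T) ^ (2 * α - 1) / T) ∂μ) ∧
        ((∫⁻ ω in A, ENNReal.ofReal
            ((rl T α (fun s => L s ω) t - rl T α (fun s => L s ω) a) ^ 2
              + ((T - a) / T) ^ (2 * α) * (L a ω) ^ 2) ∂μ)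
          = ∫⁻ ω in A, ENNReal.ofReal (2 * α *
              ∫ u in a..T, (L (min u t) ω) ^ 2 * ((T - u) / T) ^ (2 * α - 1) / T) ∂μ) := by
  intro a t ha hat htT A hA
  have ht0 : 0 ≤ t := ha.trans hat.le
  have hA' : MeasurableSet A := ℱ.le a A hA
  have hLm : ∀ s ∈ Ico (0:ℝ) T, Measurable (L s) := fun s hs =>
    ((hAdapted s hs).mono (ℱ.le s)).measurable
  have hsqi : ∀ s ∈ Ico (0:ℝ) T, Integrable (fun ω => (L s ω) ^ 2) μ := fun s hs =>
    (hL2 s hs).integrable_sq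
  have hmul : ∀ s ∈ Ico (0:ℝ) T, ∀ r ∈ Ico (0:ℝ) T, Integrable (fun ω => L s ω * L r ω) μ :=
    fun s hs r hr => (hL2 s hs).integrable_mul (hL2 r hr)
  have hmart := rl_mart ℱ T L hAdapted hL2 hMart
  -- expansion of second moments of increments
  have hexp : ∀ B : Set Ω, ∀ r s u v : ℝ, r ∈ Ico (0:ℝ) T → s ∈ Ico (0:ℝ) T → u ∈ Ico (0:ℝ) T →
      v ∈ Ico (0:ℝ) T →
      ∫ ω in B, (L r ω - L s ω) * (L u ω - L v ω) ∂μ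
        = ∫ ω in B, L r ω * L u ω ∂μ - ∫ ω in B, L r ω * L v ω ∂μ
          - (∫ ω in B, L s ω * L u ω ∂μ - ∫ ω in B, L s ω * L v ω ∂μ) := by
    intro B r s u v hr hs hu hv
    rw [← integral_sub (hmul r hr u hu).integrableOn (hmul r hr v hv).integrableOn,
      ← integral_sub (hmul s hs u hu).integrableOn (hmul s hs v hv).integrableOn, ← integral_sub]
    · congr 1; ext ω; ring
    · exact (hmul r hr u hu).integrableOn.sub (hmul r hr v hv).integrableOn
    · exact (hmul s hs u hu).integrableOn.sub (hmul s hs v hv).integrableOn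
  have hmono : ∀ B : Set Ω, ∀ u v : ℝ, 0 ≤ u → u ≤ v → v < T → MeasurableSet[ℱ u] B →
      ∫ ω in B, (L u ω) ^ 2 ∂μ ≤ ∫ ω in B, (L v ω) ^ 2 ∂μ := by
    intro B u v hu huv hv hB
    have hum : u ∈ Ico (0:ℝ) T := ⟨hu, huv.trans_lt hv⟩
    have hvm : v ∈ Ico (0:ℝ) T := ⟨hu.trans huv, hv⟩
    have h1 := hexp B v u v u hvm hum hvm hum
    have h2 := hmart u v hu huv hv B hB
    have h3 : 0 ≤ ∫ ω in B, (L v ω - L u ω) * (L v ω - L u ω) ∂μ :=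
      integral_nonneg fun ω => mul_self_nonneg _
    have h4 : ∫ ω in B, L v ω * L u ω ∂μ = ∫ ω in B, L u ω * L v ω ∂μ := by
      simp_rw [mul_comm]
    rw [h1, h4, h2] at h3
    simp_rw [← sq] at h3
    linarith
  obtain ⟨ν, hν1, hν2, hνint, hνtail⟩ := rl_nu T α hT hα a (hat.trans htT)
  set c : ℝ → ℝ := fun u => max a (min u t) with hc
  have hca : ∀ u, a ≤ c u := fun u => le_max_left _ _
  have hct : ∀ u, c u ≤ t := fun u => max_le hat.le (min_le_right _ _)
  have hcm : ∀ u, c u ∈ Ico (0:ℝ) T := fun u => ⟨ha.trans (hca u), (hct u).trans_lt htT⟩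
  have hcmono : ∀ u v, u ≤ v → c u ≤ c v := fun u v h => max_le_max le_rfl (min_le_min h le_rfl)
  have ham : a ∈ Ico (0:ℝ) T := ⟨ha, hat.trans htT⟩
  have hPmeas : Measurable (fun p : ℝ × Ω => L (c p.1) p.2) :=
    rl_jointMeas (fun u ω => L (c u) ω) (fun u => hLm _ (hcm u))
      (fun ω u => rl_clamp_rc (hCadlag ω) ha hat.le htT u)
  have hNmeas : Measurable (fun p : ℝ × Ω => L (c p.1) p.2 - L a p.2) :=
    hPmeas.sub ((hLm a ham).comp measurable_snd)
  have hFA : ∀ s, a ≤ s → MeasurableSet[ℱ s] A := fun s hs => ℱ.mono hs A hA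
  -- the second moment of the increment
  have hNsq : ∀ u, ∫ ω in A, (L (c u) ω - L a ω) ^ 2 ∂μ
      = ∫ ω in A, (L (c u) ω) ^ 2 ∂μ - ∫ ω in A, (L a ω) ^ 2 ∂μ := by
    intro u
    have h1 := hexp A (c u) a (c u) a (hcm u) ham (hcm u) ham
    have h2 := hmart a (c u) ha (hca u) (hcm u).2 A hA
    have h4 : ∫ ω in A, L (c u) ω * L a ω ∂μ = ∫ ω in A, L a ω * L (c u) ω ∂μ := by
      simp_rw [mul_comm]
    rw [h4, h2] at h1
    simp_rw [← sq] at h1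
    rw [h1]; ring
  have hP := rl_abstract (μ := μ.restrict A) (ν := ν) (fun u ω => L (c u) ω) hPmeas
    (∫ ω in A, (L t ω) ^ 2 ∂μ) (fun u => (hsqi _ (hcm u)).integrableOn)
    (fun u => hmono A (c u) t (hcm u).1 (hct u) htT (hFA _ (hca u)))
    (fun u v huv => hmart (c u) (c v) (hcm u).1 (hcmono u v huv) (hcm v).2 A (hFA _ (hca u)))
  have hQ := rl_abstract (μ := μ.restrict A) (ν := ν) (fun u ω => L a ω)
    ((hLm a ham).comp measurable_snd)
    (∫ ω in A, (L a ω) ^ 2 ∂μ) (fun u => (hsqi _ ham).integrableOn)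
    (fun u => le_rfl) (fun u v huv => by simp_rw [← sq])
  have hN := rl_abstract (μ := μ.restrict A) (ν := ν) (fun u ω => L (c u) ω - L a ω) hNmeas
    (∫ ω in A, (L t ω) ^ 2 ∂μ) (fun u => ((hL2 _ (hcm u)).sub (hL2 _ ham)).integrable_sq.integrableOn)
    (fun u => by
      rw [hNsq]
      have h1 := hmono A (c u) t (hcm u).1 (hct u) htT (hFA _ (hca u))
      have h2 : 0 ≤ ∫ ω in A, (L a ω) ^ 2 ∂μ := integral_nonneg fun ω => sq_nonneg _
      linarith)
    (fun u v huv => by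
      rw [hNsq, hexp A _ _ _ _ (hcm u) ham (hcm v) ham,
        hmart (c u) (c v) (hcm u).1 (hcmono u v huv) (hcm v).2 A (hFA _ (hca u)),
        hmart a (c v) ha (hca v) (hcm v).2 A hA]
      have h4 : ∫ ω in A, L (c u) ω * L a ω ∂μ = ∫ ω in A, L a ω * L (c u) ω ∂μ := by
        simp_rw [mul_comm]
      rw [h4, hmart a (c u) ha (hca u) (hcm u).2 A hA]
      simp_rw [← sq]; ring)
  obtain ⟨hN1, hN2, hN3, hN4, hN5⟩ := hN
  obtain ⟨hP1, hP2, hP3, hP4, hP5⟩ := hP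
  obtain ⟨hQ1, hQ2, hQ3, hQ4, hQ5⟩ := hQ
  -- right-hand sides
  have hR : ∀ f : ℝ → ℝ, 2 * ∫ u, f u * ν.real (Ioi u) ∂ν
      = 2 * α * ∫ u in a..T, f u * ((T - u) / T) ^ (2 * α - 1) / T := by
    intro f
    rw [hνint, mul_assoc, ← intervalIntegral.integral_const_mul α]
    congr 1
    rw [intervalIntegral.integral_of_le (hat.trans htT).le,
      intervalIntegral.integral_of_le (hat.trans htT).le,
      integral_Ioc_eq_integral_Ioo, integral_Ioc_eq_integral_Ioo]
    refine setIntegral_congr_fun measurableSet_Ioo fun u hu => ?_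
    have hp : 0 < T - u := by linarith [hu.2]
    rw [hνtail u ⟨hu.1.le, hu.2⟩, Real.div_rpow hp.le hT.le, Real.div_rpow hp.le hT.le,
      show 2 * α - 1 = (α - 1) + α by ring, Real.rpow_add hp, Real.rpow_add hT,
      Real.rpow_sub_one hT.ne']
    have := Real.rpow_pos_of_pos hT α
    field_simp
  -- integrals only see the clamped path
  have hclamp : ∀ (φ : ℝ → ℝ → ℝ) (ω : Ω),
      ∫ u in a..T, φ u (L (min u t) ω) = ∫ u in a..T, φ u (L (c u) ω) := by
    intro φ ω
    refine intervalIntegral.integral_congr fun u hu => ?_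
    rw [uIcc_of_le (hat.trans htT).le] at hu
    simp only [hc]
    rw [max_eq_right (le_min hu.1 hat.le)]
  -- the pathwise identity
  have hpath : ∀ᵐ ω ∂μ, rl T α (fun s => L s ω) t - rl T α (fun s => L s ω) a
      = ∫ u, (L (c u) ω - L a ω) ∂ν := by
    have hM0 : Measurable (fun p : ℝ × Ω => L (max 0 (min p.1 t)) p.2) :=
      rl_jointMeas (fun u ω => L (max 0 (min u t)) ω)
        (fun u => hLm _ ⟨le_max_left _ _, (max_le ht0 (min_le_right _ _)).trans_lt htT⟩)
        (fun ω u => rl_clamp_rc (hCadlag ω) le_rfl ht0 htT u)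
    have hI := rl_sqInt (μ := μ) (ν := volume.restrict (Ioc 0 t)) (fun u ω => L (max 0 (min u t)) ω)
      hM0 (∫ ω, (L t ω) ^ 2 ∂μ)
      (fun u => hsqi _ ⟨le_max_left _ _, (max_le ht0 (min_le_right _ _)).trans_lt htT⟩)
      (fun u => by
        simpa using hmono univ (max 0 (min u t)) t (le_max_left _ _)
          (max_le ht0 (min_le_right _ _)) htT MeasurableSet.univ)
    filter_upwards [hI.prod_left_ae] with ω hω
    rw [hνint]
    refine rl_path T α hT hα a t ha hat htT (fun s => L s ω) ?_
    have h1 : Integrable (fun u => L (max 0 (min u t)) ω) (volume.restrict (Ioc 0 t)) := by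
      refine ((integrable_const (1:ℝ)).add hω).mono'
        (hM0.comp (measurable_id.prodMk measurable_const)).aestronglyMeasurable
        (Eventually.of_forall fun u => ?_)
      simp only [Real.norm_eq_abs, Pi.add_apply]
      rw [abs_le]
      constructor <;> nlinarith [sq_nonneg (L (max 0 (min u t)) ω - 1), sq_nonneg (L (max 0 (min u t)) ω + 1)]
    have h2 : IntervalIntegrable (fun u => L (max 0 (min u t)) ω) volume 0 t :=
      (intervalIntegrable_iff_integrableOn_Ioc_of_le ht0).2 h1
    have h3 : ContinuousOn (fun u : ℝ => (T - u) ^ (α - 1)) (uIcc 0 t) := by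
      rw [uIcc_of_le ht0]
      intro u hu
      have : T - u ≠ 0 := by linarith [hu.2]
      exact (ContinuousAt.rpow_const (by fun_prop) (Or.inl this)).continuousWithinAt
    refine (h2.continuousOn_mul h3).congr fun u hu => ?_
    rw [uIoc_of_le ht0] at hu
    rw [min_eq_left hu.2, max_eq_right hu.1.le]
  have hpathA := ae_restrict_of_ae (s := A) hpath
  have hνa : ν.real univ = ((T - a) / T) ^ α := by
    have h := hνint (fun _ => 1)
    simp only [mul_one] at h
    rw [rl_weight T α hT hα a (hat.trans htT).le] at h
    simpa using h
  have hQsq : ∀ ω, (∫ _u, L a ω ∂ν) ^ 2 = ((T - a) / T) ^ (2 * α) * (L a ω) ^ 2 := by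
    intro ω
    have hp : 0 ≤ (T - a) / T := div_nonneg (by linarith) hT.le
    rw [integral_const, hνa, smul_eq_mul, mul_pow, mul_comm 2 α, Real.rpow_mul hp, Real.rpow_two]
  constructor
  · have e1 : ∫⁻ ω in A, ENNReal.ofReal
            ((rl T α (fun s => L s ω) t - rl T α (fun s => L s ω) a) ^ 2) ∂μ
        = ∫⁻ ω in A, ENNReal.ofReal ((∫ u, (L (c u) ω - L a ω) ∂ν) ^ 2) ∂μ := by
      refine lintegral_congr_ae ?_
      filter_upwards [hpathA] with ω hω
      rw [hω]
    have e2 : ∀ ω, 2 * α * ∫ u in a..T, (L (min u t) ω - L a ω) ^ 2 * ((T - u) / T) ^ (2 * α - 1) / T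
        = 2 * ∫ u, (L (c u) ω - L a ω) ^ 2 * ν.real (Ioi u) ∂ν := by
      intro ω
      rw [hR, hclamp (fun u x => (x - L a ω) ^ 2 * ((T - u) / T) ^ (2 * α - 1) / T)]
    simp_rw [e2]
    rw [e1, ← ofReal_integral_eq_lintegral_ofReal hN1 (Eventually.of_forall fun ω => sq_nonneg _),
      ← ofReal_integral_eq_lintegral_ofReal (hN2.const_mul 2) (Eventually.of_forall fun ω => ?_),
      integral_const_mul, hN4, hN5]
    exact mul_nonneg zero_le_two (integral_nonneg fun u => mul_nonneg (sq_nonneg _) measureReal_nonneg)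
  · have e1 : ∫⁻ ω in A, ENNReal.ofReal
            ((rl T α (fun s => L s ω) t - rl T α (fun s => L s ω) a) ^ 2
              + ((T - a) / T) ^ (2 * α) * (L a ω) ^ 2) ∂μ
        = ∫⁻ ω in A, ENNReal.ofReal ((∫ u, (L (c u) ω - L a ω) ∂ν) ^ 2 + (∫ _u, L a ω ∂ν) ^ 2) ∂μ := by
      refine lintegral_congr_ae ?_
      filter_upwards [hpathA] with ω hω
      rw [hω, hQsq]
    have e2 : ∀ ω, 2 * α * ∫ u in a..T, (L (min u t) ω) ^ 2 * ((T - u) / T) ^ (2 * α - 1) / T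
        = 2 * ∫ u, (L (c u) ω) ^ 2 * ν.real (Ioi u) ∂ν := by
      intro ω
      rw [hR, hclamp (fun u x => x ^ 2 * ((T - u) / T) ^ (2 * α - 1) / T)]
    simp_rw [e2]
    have hNQ : Integrable (fun ω => (∫ u, (L (c u) ω - L a ω) ∂ν) ^ 2 + (∫ _u, L a ω ∂ν) ^ 2)
        (μ.restrict A) := hN1.add hQ1
    rw [e1, ← ofReal_integral_eq_lintegral_ofReal hNQ
        (Eventually.of_forall fun ω => add_nonneg (sq_nonneg _) (sq_nonneg _)),
      ← ofReal_integral_eq_lintegral_ofReal (hP2.const_mul 2) (Eventually.of_forall fun ω => ?_),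
      integral_const_mul, integral_add hN1 hQ1, hN4, hQ4, hP5, ← mul_add, ← integral_add hN3 hQ3]
    · congr 2
      refine integral_congr_ae (Eventually.of_forall fun u => ?_)
      simp only
      rw [hNsq]; ring
    exact mul_nonneg zero_le_two (integral_nonneg fun u => mul_nonneg (sq_nonneg _) measureReal_nonneg)
end

section
/- Let T>0, α>0, and let L=(L_t)_{t∈[0,T)} be a càdlàg martingale with L_0≡0 on a complete filtered probability space satisfying the usual conditions. Then ‖I^α L‖_{BMO_2([0,T))} ≤ (3√(2α)/T^α) · ( ∫_0^T (T−t)^{2α−1} ‖L_t‖_{L_∞}² dt )^{1/2}. -/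
open MeasureTheory Filter Set ENNReal

lemma aux_l2 {Ω : Type*} {mΩ : MeasurableSpace Ω} (μ : Measure Ω) [IsFiniteMeasure μ]
    (ν : Measure ℝ) [IsFiniteMeasure ν] (G : ℝ → Ω → ℝ) (hG : Measurable (Function.uncurry G))
    (C : ℝ) (hC : ∀ u ω, |G u ω| ≤ C) (w β : ℝ → ℝ) (hw : Measurable w) (hβ : Measurable β)
    (hw0 : ∀ u, 0 ≤ w u) (hβ0 : ∀ u, 0 ≤ β u) (Cw Cβ : ℝ) (hCw : ∀ u, w u ≤ Cw)
    (hCβ : ∀ u, β u ≤ Cβ) (m : ℝ) (hm : 0 ≤ m)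
    (hcov : ∀ u v, u ≤ v → ∫ ω, G u ω * G v ω ∂μ ≤ m * (w u * w v * β u)) :
    ∫ ω, (∫ u, G u ω ∂ν) ^ 2 ∂μ ≤ 2 * m * ∫ u, w u * β u * (∫ v in Ici u, w v ∂ν) ∂ν := by
  have hC0 : 0 ≤ C ∨ IsEmpty Ω := by
    rcases isEmpty_or_nonempty Ω with h | ⟨⟨ω⟩⟩
    · exact Or.inr h
    · exact Or.inl ((abs_nonneg _).trans (hC 0 ω))
  have hCw0 : 0 ≤ Cw := (hw0 0).trans (hCw 0)
  have hCβ0 : 0 ≤ Cβ := (hβ0 0).trans (hCβ 0)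
  set H : ℝ × ℝ → ℝ := fun p => {p : ℝ × ℝ | p.1 ≤ p.2}.indicator
    (fun p => w p.1 * w p.2 * β p.1) p with hH
  have hHm : Measurable H := by
    apply Measurable.indicator
    · fun_prop
    · exact measurableSet_le measurable_fst measurable_snd
  have hH0 : ∀ p, 0 ≤ H p := fun p => Set.indicator_nonneg
    (fun p _ => mul_nonneg (mul_nonneg (hw0 _) (hw0 _)) (hβ0 _)) p
  have hHi : Integrable H (ν.prod ν) := by
    apply Integrable.of_bound hHm.aestronglyMeasurable (Cw * Cw * Cβ)
    refine ae_of_all _ fun p => ?_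
    rw [Real.norm_of_nonneg (hH0 p)]
    refine (Set.indicator_le_self' (fun p _ => mul_nonneg (mul_nonneg (hw0 _) (hw0 _)) (hβ0 _)) p).trans ?_
    have h1 := hw0 p.1
    have h2 := hw0 p.2
    have h3 := hβ0 p.1
    have h4 := hCw p.1
    have h5 := hCw p.2
    have h6 := hCβ p.1
    gcongr
  have hGG : Integrable (Function.uncurry fun (ω : Ω) (p : ℝ × ℝ) => G p.1 ω * G p.2 ω)
      (μ.prod (ν.prod ν)) := by
    refine Integrable.of_bound ?_ (C * C) (ae_of_all _ fun p => ?_)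
    · apply Measurable.aestronglyMeasurable
      have h1 : Measurable fun q : Ω × (ℝ × ℝ) => G q.2.1 q.1 :=
        hG.comp (f := fun q : Ω × (ℝ × ℝ) => (q.2.1, q.1)) (by fun_prop)
      have h2 : Measurable fun q : Ω × (ℝ × ℝ) => G q.2.2 q.1 :=
        hG.comp (f := fun q : Ω × (ℝ × ℝ) => (q.2.2, q.1)) (by fun_prop)
      exact h1.mul h2
    · simp only [Function.uncurry, Real.norm_eq_abs, abs_mul]
      have h1 := hC p.2.1 p.1
      have h2 := hC p.2.2 p.1
      have := (abs_nonneg _).trans h1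
      gcongr
  have e1 : ∫ ω, (∫ u, G u ω ∂ν) ^ 2 ∂μ = ∫ ω, ∫ p : ℝ × ℝ, G p.1 ω * G p.2 ω ∂(ν.prod ν) ∂μ := by
    congr 1; ext ω
    rw [integral_prod_mul (fun u => G u ω) (fun u => G u ω), sq]
  rw [e1, integral_integral_swap hGG]
  have e2 : ∫ p : ℝ × ℝ, H p.swap ∂(ν.prod ν) = ∫ p, H p ∂(ν.prod ν) := integral_prod_swap H
  have hHs : Integrable (fun p : ℝ × ℝ => H p.swap) (ν.prod ν) := hHi.swap
  have e3 : ∫ p, H p ∂(ν.prod ν) = ∫ u, w u * β u * (∫ v in Ici u, w v ∂ν) ∂ν := by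
    rw [integral_prod _ hHi]
    congr 1; ext u
    rw [← integral_indicator measurableSet_Ici, ← integral_const_mul]
    congr 1; ext v
    by_cases h : u ≤ v
    · simp [hH, h]; ring
    · simp [hH, h]
  calc _ ≤ ∫ p : ℝ × ℝ, m * (H p + H p.swap) ∂(ν.prod ν) := by
        apply integral_mono
        · exact hGG.swap.integral_prod_left
        · exact (hHi.add hHs).const_mul m
        · intro p
          rcases le_total p.1 p.2 with h | h
          · refine (hcov _ _ h).trans ?_
            have : H p = w p.1 * w p.2 * β p.1 := by simp [hH, h]
            rw [← this]
            have := hH0 p.swap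
            exact mul_le_mul_of_nonneg_left (by linarith) hm
          · have h' := hcov _ _ h
            have : H p.swap = w p.2 * w p.1 * β p.2 := by simp [hH, h]
            rw [← this] at h'
            have := hH0 p
            simp_rw [mul_comm (G p.1 _)]
            refine h'.trans ?_
            exact mul_le_mul_of_nonneg_left (by linarith) hm
    _ = _ := by
        rw [integral_const_mul, integral_add hHi hHs, e2, e3]; ring

lemma aux_rc (f : ℝ → ℝ) (T c : ℝ)
    (hf : ∀ s ∈ Ico 0 T, Tendsto f (nhdsWithin s (Ici s)) (nhds (f s)))
    (hq : ∀ q : ℚ, (q : ℝ) ∈ Ico 0 T → f q ≤ c) : ∀ s ∈ Ico 0 T, f s ≤ c := by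
  intro s hs
  by_contra! h
  have h1 : ∀ᶠ x in nhdsWithin s (Ioi s), c < f x :=
    ((hf s hs).mono_left (nhdsWithin_mono _ Ioi_subset_Ici_self)).eventually (lt_mem_nhds h)
  have h2 : ∀ᶠ x in nhdsWithin s (Ioi s), x ∈ Ioo s T := Ioo_mem_nhdsGT hs.2
  obtain ⟨b, hb, hb'⟩ := (mem_nhdsGT_iff_exists_Ioo_subset).1 (h1.and h2)
  obtain ⟨q, hq1, hq2⟩ := exists_rat_btwn (mem_Ioi.1 hb)
  have := hb' ⟨hq1, hq2⟩
  exact absurd (hq q ⟨hs.1.trans hq1.le, this.2.2⟩) (not_le.2 this.1)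

lemma aux_int (T α q t : ℝ) (hα : 0 < α) :
    ∫ v in q..t, (T - v) ^ (α - 1) = ((T - q) ^ α - (T - t) ^ α) / α := by
  rw [intervalIntegral.integral_comp_sub_left (fun x => x ^ (α - 1)) T,
    integral_rpow (Or.inl (by linarith))]
  simp

lemma aux_ii (T α q t : ℝ) (hα : 0 < α) :
    IntervalIntegrable (fun v => (T - v) ^ (α - 1)) volume q t := by
  have := (intervalIntegral.intervalIntegrable_rpow' (a := T - q) (b := T - t) (r := α - 1) (by linarith)).comp_sub_left T
  simpa using this

lemma aux_lint (T α q : ℝ) (hα : 0 < α) (hq : q ≤ T) :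
    ∫⁻ v in Ioo q T, ENNReal.ofReal ((T - v) ^ (2 * α - 1))
      = ENNReal.ofReal ((T - q) ^ (2 * α) / (2 * α)) := by
  have h := aux_int T (2 * α) q T (by linarith)
  have hi := aux_ii T (2 * α) q T (by linarith)
  rw [sub_self, Real.zero_rpow (by linarith), sub_zero] at h
  rw [← h, intervalIntegral.integral_of_le hq, integral_Ioc_eq_integral_Ioo,
    ofReal_integral_eq_lintegral_ofReal]
  · exact ((intervalIntegrable_iff_integrableOn_Ioc_of_le hq).1 hi).mono_set Ioo_subset_Ioc_self
  · filter_upwards [ae_restrict_mem measurableSet_Ioo] with v hv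
    exact Real.rpow_nonneg (by linarith [hv.2]) _

lemma aux_jm {Ω : Type*} {mΩ : MeasurableSpace Ω} (L : ℝ → Ω → ℝ) (T : ℝ)
    (hm : ∀ t ∈ Ico 0 T, Measurable (L t))
    (hrc : ∀ ω, ∀ s ∈ Ico 0 T, Tendsto (fun s => L s ω) (nhdsWithin s (Ici s)) (nhds (L s ω))) :
    Measurable (Function.uncurry fun u ω => (Ico 0 T).indicator (fun u => L u ω) u) := by
  classical
  let F : ℕ → ℝ × Ω → ℝ := fun n p =>
    (Ico (0:ℝ) T).indicator (fun u => if (((⌊(n + 1) * u⌋ : ℤ) : ℝ) + 1) / (n + 1) ∈ Ico 0 T then 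
        L ((((⌊(n + 1) * u⌋ : ℤ) : ℝ) + 1) / (n + 1)) p.2 else 0) p.1
  refine measurable_of_tendsto_metrizable (f := F) ?_ ?_
  · intro n
    have h1 : Measurable fun q : ℤ × Ω => if (((q.1 : ℝ) + 1) / (n + 1)) ∈ Ico 0 T then
        L (((q.1 : ℝ) + 1) / (n + 1)) q.2 else 0 := by
      refine measurable_from_prod_countable_right fun k => ?_
      by_cases hk : (((k : ℝ) + 1) / (n + 1)) ∈ Ico 0 T
      · simp only [hk, if_true]; exact hm _ hk
      · simp only [hk, if_false]; exact measurable_const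
    have h2 : Measurable fun p : ℝ × Ω => ((⌊((n:ℝ) + 1) * p.1⌋ : ℤ), p.2) := by
      refine Measurable.prodMk ?_ measurable_snd
      exact Int.measurable_floor.comp (by fun_prop)
    have h3 := (h1.comp h2).indicator (s := Prod.fst ⁻¹' Ico (0:ℝ) T) (measurable_fst measurableSet_Ico)
    exact h3
  · rw [tendsto_pi_nhds]
    rintro ⟨u, ω⟩
    by_cases hu : u ∈ Ico 0 T
    · simp only [F, Function.uncurry, indicator_of_mem hu]
      have hlim : Tendsto (fun n : ℕ => (((⌊((n:ℝ) + 1) * u⌋ : ℤ) : ℝ) + 1) / (n + 1)) atTop (nhdsWithin u (Ici u)) := by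
        rw [tendsto_nhdsWithin_iff]
        have hge : ∀ n : ℕ, u ≤ (((⌊((n:ℝ) + 1) * u⌋ : ℤ) : ℝ) + 1) / (n + 1) := by
          intro n
          rw [le_div_iff₀ (by positivity), mul_comm]
          exact (Int.lt_floor_add_one _).le
        refine ⟨?_, Eventually.of_forall hge⟩
        refine tendsto_of_tendsto_of_tendsto_of_le_of_le (h := fun n : ℕ => u + 1 / ((n:ℝ) + 1))
          tendsto_const_nhds ?_ hge ?_
        · simpa using tendsto_const_nhds.add (tendsto_one_div_add_atTop_nhds_zero_nat (𝕜 := ℝ))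
        · intro n
          have := Int.floor_le (((n:ℝ) + 1) * u)
          simp only
          rw [div_le_iff₀ (by positivity)]
          field_simp
          linarith
      have hin : ∀ᶠ n : ℕ in atTop, (((⌊((n:ℝ) + 1) * u⌋ : ℤ) : ℝ) + 1) / (n + 1) ∈ Ico 0 T := by
        have : Ico 0 T ∈ nhdsWithin u (Ici u) :=
          mem_of_superset (Ico_mem_nhdsGE hu.2) (Ico_subset_Ico_left hu.1)
        exact hlim this
      refine ((hrc ω u hu).comp hlim).congr' ?_
      filter_upwards [hin] with n hn
      simp [hn]
    · simp only [F, Function.uncurry, indicator_of_notMem hu]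
      exact tendsto_const_nhds

lemma aux_mart {Ω : Type*} {mΩ : MeasurableSpace Ω} {μ : Measure Ω} [IsProbabilityMeasure μ]
    (m : MeasurableSpace Ω) (hm : m ≤ mΩ) (X Y : Ω → ℝ) (hX : StronglyMeasurable[m] X)
    (hY : Integrable Y μ) (hXY : μ[Y | m] =ᵐ[μ] X) (c : ℝ) (hc : ∀ᵐ ω ∂μ, |X ω| ≤ c)
    (B A : Set Ω) (hB : MeasurableSet[m] B) (hBA : B ⊆ A) :
    ∫ ω, B.indicator X ω * Y ω ∂μ ≤ μ.real A * c ^ 2 := by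
  have hBX : StronglyMeasurable[m] (B.indicator X) := hX.indicator hB
  have hbd : ∀ᵐ ω ∂μ, ‖B.indicator X ω‖ ≤ c := by
    filter_upwards [hc] with ω h
    exact (norm_indicator_le_norm_self _ _).trans h
  have h1 := condExp_stronglyMeasurable_mul_of_bound hm hBX hY c hbd
  have h2 : ∫ ω, B.indicator X ω * Y ω ∂μ = ∫ ω, B.indicator X ω * X ω ∂μ := by
    rw [← integral_condExp hm (f := fun ω => B.indicator X ω * Y ω)]
    apply integral_congr_ae
    filter_upwards [h1, hXY] with ω h h'
    rw [← h']; exact h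
  rw [h2]
  have h3 : ∀ᵐ ω ∂μ, B.indicator X ω * X ω ≤ B.indicator (fun _ => c ^ 2) ω := by
    filter_upwards [hc] with ω h
    by_cases hω : ω ∈ B
    · simp only [indicator_of_mem hω]
      have := abs_nonneg (X ω)
      rw [← sq, ← sq_abs]; gcongr
    · simp [hω]
  calc _ ≤ ∫ ω, B.indicator (fun _ => c ^ 2) ω ∂μ := by
        apply integral_mono_of_nonneg _ _ h3
        · refine ae_of_all _ fun ω => ?_
          by_cases hω : ω ∈ B
          · simp only [indicator_of_mem hω]; exact mul_self_nonneg _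
          · simp [hω]
        · exact (integrable_const _).indicator (hm _ hB)
    _ = μ.real B * c ^ 2 := by
        rw [integral_indicator_const _ (hm _ hB)]; simp
    _ ≤ _ := by
        have := measureReal_mono (μ := μ) hBA
        gcongr

lemma aux_I {Ω : Type*} {mΩ : MeasurableSpace Ω} {μ : Measure Ω} [IsProbabilityMeasure μ]
    (ℱ : Filtration ℝ mΩ) (T : ℝ) (α : ℝ) (hα : 0 < α)
    (L : ℝ → Ω → ℝ)
    (hCadlag : ∀ ω, ∀ s ∈ Ico 0 T, Tendsto (fun s => L s ω) (nhdsWithin s (Ici s)) (nhds (L s ω)))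
    (hAdapted : ∀ t ∈ Set.Ico (0:ℝ) T, StronglyMeasurable[ℱ t] (L t))
    (hInt : ∀ t ∈ Set.Ico (0:ℝ) T, Integrable (L t) μ)
    (hMart : ∀ s t : ℝ, s ∈ Set.Ico (0:ℝ) T → t ∈ Set.Ico (0:ℝ) T → s ≤ t →
      μ[L t | ℱ s] =ᵐ[μ] L s)
    (t : ℝ) (ht : t ∈ Ico 0 T) (σ : Ω → ℝ) (hσm : Measurable σ) (hσ : ∀ ω, σ ω ∈ Icc 0 t)
    (A : Set Ω) (hAm : MeasurableSet A) (hA : ∀ u, MeasurableSet[ℱ u] (A ∩ {ω | σ ω ≤ u}))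
    (M : ℝ) (hM0 : 0 ≤ M) (hM : ∀ᵐ ω ∂μ, ∀ u ∈ Icc 0 t, |L u ω| ≤ M)
    (a : ℝ → ℝ) (ha : Monotone a) (Ca : ℝ) (ha0 : ∀ u, 0 ≤ a u) (hCa : ∀ u, a u ≤ Ca)
    (haL : ∀ u ∈ Icc 0 t, ∀ᵐ ω ∂μ, |L u ω| ≤ a u) (J : ℝ)
    (hJ : ∫ u in Icc 0 t, (T - u) ^ (2 * α - 1) * a u ^ 2 ≤ J) :
    ∫⁻ ω in A, ENNReal.ofReal ((α * ∫ u in (σ ω)..t, (T - u) ^ (α - 1) * L u ω) ^ 2) ∂μ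
      ≤ ENNReal.ofReal (2 * α * J) * μ A := by
  classical
  set ν : Measure ℝ := volume.restrict (Icc 0 t) with hν
  have hcont : ∀ γ : ℝ, ContinuousOn (fun u => (T - u) ^ γ) (Icc 0 t) := by
    intro γ
    apply ContinuousOn.rpow_const (by fun_prop)
    intro x hx; left; linarith [hx.2, ht.2]
  set w : ℝ → ℝ := (Icc 0 t).indicator fun u => (T - u) ^ (α - 1) with hw
  have hpos : ∀ γ : ℝ, ∀ u ∈ Icc 0 t, 0 ≤ (T - u) ^ γ := fun γ u hu =>
    Real.rpow_nonneg (by linarith [hu.2, ht.2]) _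
  have hw0 : ∀ u, 0 ≤ w u := fun u => indicator_nonneg (hpos _) u
  have hwm : Measurable w := by
    apply Measurable.indicator _ measurableSet_Icc
    fun_prop
  obtain ⟨Cw, hCw⟩ := isCompact_Icc.exists_bound_of_continuousOn (hcont (α - 1))
  have hCw0 : 0 ≤ Cw := (norm_nonneg _).trans (hCw 0 ⟨le_rfl, ht.1⟩)
  have hCw' : ∀ u, w u ≤ Cw := by
    intro u
    by_cases hu : u ∈ Icc 0 t
    · simp only [hw, indicator_of_mem hu]; exact (le_abs_self _).trans (hCw u hu)
    · simp only [hw, indicator_of_notMem hu]; exact hCw0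
  set Lt : ℝ → Ω → ℝ := fun u ω => (Ico 0 T).indicator (fun u => L u ω) u with hLt
  have hLtm : Measurable (Function.uncurry Lt) :=
    aux_jm L T (fun s hs => ((hAdapted s hs).mono (ℱ.le s)).measurable) hCadlag
  set D : Set (ℝ × Ω) := {p | p.2 ∈ A ∧ σ p.2 ≤ p.1} with hD
  have hDm : MeasurableSet D := by
    apply MeasurableSet.inter (measurable_snd hAm)
    exact measurableSet_le (hσm.comp measurable_snd) measurable_fst
  set G : ℝ → Ω → ℝ := fun u ω =>
    w u * D.indicator (fun p => max (-M) (min M (Lt p.1 p.2))) (u, ω) with hG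
  have hGm : Measurable (Function.uncurry G) := by
    have h1 : Measurable (D.indicator (fun p => max (-M) (min M (Lt p.1 p.2)))) := by
      apply Measurable.indicator _ hDm
      exact measurable_const.max (measurable_const.min hLtm)
    exact (hwm.comp measurable_fst).mul h1
  have hclamp : ∀ x : ℝ, |max (-M) (min M x)| ≤ M := by
    intro x
    rw [abs_le]
    exact ⟨le_max_left _ _, max_le (by linarith) (min_le_left _ _)⟩
  have hclamp' : ∀ x : ℝ, |x| ≤ M → max (-M) (min M x) = x := by
    intro x hx
    rw [abs_le] at hx
    rw [min_eq_right hx.2, max_eq_right hx.1]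
  have hGb : ∀ u ω, |G u ω| ≤ Cw * M := by
    intro u ω
    simp only [hG, abs_mul, abs_of_nonneg (hw0 u)]
    refine mul_le_mul (hCw' u) ?_ (abs_nonneg _) hCw0
    by_cases h : (u, ω) ∈ D
    · simp only [indicator_of_mem h]; exact hclamp _
    · simp only [indicator_of_notMem h]; simpa using hM0
  have hIcc : ∀ u ∈ Icc 0 t, u ∈ Ico 0 T := fun u hu => ⟨hu.1, hu.2.trans_lt ht.2⟩
  have hcov : ∀ u v, u ≤ v → ∫ ω, G u ω * G v ω ∂μ ≤ μ.real A * (w u * w v * (a u) ^ 2) := by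
    intro u v huv
    by_cases hu : u ∈ Icc 0 t
    swap
    · simp [hG, hw, indicator_of_notMem hu]
    by_cases hv : v ∈ Icc 0 t
    swap
    · simp [hG, hw, indicator_of_notMem hv]
    have e : ∫ ω, G u ω * G v ω ∂μ
        = w u * w v * ∫ ω, (A ∩ {ω | σ ω ≤ u}).indicator (L u) ω * L v ω ∂μ := by
      rw [← integral_const_mul]
      apply integral_congr_ae
      filter_upwards [hM] with ω hω
      by_cases h : ω ∈ A ∩ {ω | σ ω ≤ u}
      · have h1 : (u, ω) ∈ D := ⟨h.1, h.2⟩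
        have h2 : (v, ω) ∈ D := ⟨h.1, le_trans h.2 huv⟩
        simp only [hG, indicator_of_mem h, indicator_of_mem h1, indicator_of_mem h2, hLt,
          indicator_of_mem (hIcc u hu), indicator_of_mem (hIcc v hv), hclamp' _ (hω u hu),
          hclamp' _ (hω v hv)]
        ring
      · have h1 : (u, ω) ∉ D := fun h1 => h ⟨h1.1, h1.2⟩
        simp only [hG, indicator_of_notMem h, indicator_of_notMem h1]
        ring
    rw [e]
    have := aux_mart (μ := μ) (ℱ u) (ℱ.le u) (L u) (L v) (hAdapted u (hIcc u hu))
      (hInt v (hIcc v hv)) (hMart u v (hIcc u hu) (hIcc v hv) huv) (a u) (haL u hu) _ A (hA u)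
      inter_subset_left
    calc _ ≤ w u * w v * (μ.real A * a u ^ 2) :=
          mul_le_mul_of_nonneg_left this (mul_nonneg (hw0 u) (hw0 v))
      _ = _ := by ring
  have ham : Measurable fun u => a u ^ 2 := ha.measurable.pow_const 2
  have hCa2 : ∀ u, a u ^ 2 ≤ Ca ^ 2 := fun u => pow_le_pow_left₀ (ha0 u) (hCa u) 2
  have key := aux_l2 μ ν G hGm (Cw * M) hGb w (fun u => a u ^ 2) hwm ham hw0
    (fun u => sq_nonneg _) Cw (Ca ^ 2) hCw' hCa2 (μ.real A) measureReal_nonneg hcov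
  have hinner : ∀ u ∈ Icc 0 t, ∫ v in Ici u, w v ∂ν ≤ (T - u) ^ α / α := by
    intro u hu
    have e : ∫ v in Ici u, w v ∂ν = ∫ v in u..t, (T - v) ^ (α - 1) := by
      rw [hν, Measure.restrict_restrict measurableSet_Ici, intervalIntegral.integral_of_le hu.2,
        ← integral_Icc_eq_integral_Ioc]
      have : Ici u ∩ Icc 0 t = Icc u t := by
        ext x; simp only [mem_inter_iff, mem_Ici, mem_Icc]
        constructor
        · rintro ⟨h1, h2, h3⟩; exact ⟨h1, h3⟩
        · rintro ⟨h1, h2⟩; exact ⟨h1, hu.1.trans h1, h2⟩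
      rw [this]
      apply setIntegral_congr_fun measurableSet_Icc
      intro v hv
      have hv' : v ∈ Icc 0 t := ⟨hu.1.trans hv.1, hv.2⟩
      simp only [hw, indicator_of_mem hv']
    rw [e, aux_int T α u t hα]
    have : 0 ≤ (T - t) ^ α := hpos α t ⟨ht.1, le_rfl⟩
    gcongr; linarith
  have hfin : ∫ u, w u * a u ^ 2 * (∫ v in Ici u, w v ∂ν) ∂ν ≤ J / α := by
    have hJi : Integrable (fun u => (T - u) ^ (2 * α - 1) * a u ^ 2) ν := by
      obtain ⟨C, hC⟩ := isCompact_Icc.exists_bound_of_continuousOn (hcont (2 * α - 1))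
      have hC0 : 0 ≤ C := (norm_nonneg _).trans (hC 0 ⟨le_rfl, ht.1⟩)
      refine Integrable.of_bound ?_ (C * Ca ^ 2) ?_
      · apply Measurable.aestronglyMeasurable
        exact Measurable.mul (by fun_prop) ham
      · filter_upwards [ae_restrict_mem measurableSet_Icc] with u hu
        rw [norm_mul]
        refine mul_le_mul (hC u hu) ?_ (norm_nonneg _) hC0
        rw [Real.norm_of_nonneg (sq_nonneg _)]; exact hCa2 u
    calc _ ≤ ∫ u, ((T - u) ^ (2 * α - 1) * a u ^ 2) / α ∂ν := by
          apply integral_mono_of_nonneg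
          · refine ae_of_all _ fun u => ?_
            exact mul_nonneg (mul_nonneg (hw0 u) (sq_nonneg _)) (integral_nonneg hw0)
          · exact hJi.div_const α
          · filter_upwards [ae_restrict_mem measurableSet_Icc] with u hu
            refine (mul_le_mul_of_nonneg_left (hinner u hu)
              (mul_nonneg (hw0 u) (sq_nonneg _))).trans (le_of_eq ?_)
            simp only [hw, indicator_of_mem hu]
            have : (T - u) ^ (2 * α - 1) = (T - u) ^ (α - 1) * (T - u) ^ α := by
              rw [← Real.rpow_add (by linarith [hu.2, ht.2])]; congr 1; ring
            rw [this]; ring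
      _ = (∫ u, ((T - u) ^ (2 * α - 1) * a u ^ 2) ∂ν) / α := integral_div _ _
      _ ≤ _ := by gcongr
  have hGint : ∀ᵐ ω ∂μ, ω ∈ A →
      ∫ u in (σ ω)..t, (T - u) ^ (α - 1) * L u ω = ∫ u, G u ω ∂ν := by
    filter_upwards [hM] with ω hω hωA
    rw [intervalIntegral.integral_of_le (hσ ω).2, ← integral_Icc_eq_integral_Ioc,
      ← integral_indicator measurableSet_Icc, hν, ← integral_indicator measurableSet_Icc]
    congr 1; ext u
    by_cases hu : u ∈ Icc 0 t
    · by_cases hs : σ ω ≤ u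
      · have h1 : u ∈ Icc (σ ω) t := ⟨hs, hu.2⟩
        have h2 : (u, ω) ∈ D := ⟨hωA, hs⟩
        simp only [indicator_of_mem h1, indicator_of_mem hu, hG, hw, indicator_of_mem h2, hLt,
          indicator_of_mem (hIcc u hu), hclamp' _ (hω u hu)]
      · have h1 : u ∉ Icc (σ ω) t := fun h => hs h.1
        have h2 : (u, ω) ∉ D := fun h => hs h.2
        simp only [indicator_of_notMem h1, indicator_of_mem hu, hG, indicator_of_notMem h2,
          mul_zero]
    · have h1 : u ∉ Icc (σ ω) t := fun h => hu ⟨(hσ ω).1.trans h.1, h.2⟩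
      simp only [indicator_of_notMem h1, indicator_of_notMem hu]
  have hIm : StronglyMeasurable fun ω => ∫ u, G u ω ∂ν := by
    have : StronglyMeasurable (fun p : Ω × ℝ => G p.2 p.1) :=
      (hGm.comp measurable_swap).stronglyMeasurable
    exact this.integral_prod_right'
  have hIi : Integrable (fun ω => (α * ∫ u, G u ω ∂ν) ^ 2) μ := by
    refine Integrable.of_bound ((hIm.const_mul α).pow 2).aestronglyMeasurable
      ((α * (Cw * M * ν.real univ)) ^ 2) (ae_of_all _ fun ω => ?_)
    have := norm_integral_le_of_norm_le_const (μ := ν) (f := fun u => G u ω) (C := Cw * M)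
      (ae_of_all _ fun u => hGb u ω)
    rw [norm_pow, norm_mul, Real.norm_of_nonneg hα.le]
    gcongr
  calc _ ≤ ∫⁻ ω in A, ENNReal.ofReal ((α * ∫ u, G u ω ∂ν) ^ 2) ∂μ := by
        apply lintegral_mono_ae
        refine (ae_restrict_iff' hAm).2 ?_
        filter_upwards [hGint] with ω h hω
        rw [h hω]
    _ ≤ ∫⁻ ω, ENNReal.ofReal ((α * ∫ u, G u ω ∂ν) ^ 2) ∂μ := setLIntegral_le_lintegral _ _
    _ = ENNReal.ofReal (∫ ω, (α * ∫ u, G u ω ∂ν) ^ 2 ∂μ) := by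
        rw [ofReal_integral_eq_lintegral_ofReal hIi (ae_of_all _ fun ω => sq_nonneg _)]
    _ ≤ ENNReal.ofReal (2 * α * J * μ.real A) := by
        apply ENNReal.ofReal_le_ofReal
        simp_rw [mul_pow]
        rw [integral_const_mul]
        calc _ ≤ α ^ 2 * (2 * μ.real A * (J / α)) := by
              apply mul_le_mul_of_nonneg_left _ (sq_nonneg _)
              refine key.trans (mul_le_mul_of_nonneg_left hfin (by positivity))
          _ = _ := by field_simp
    _ = _ := by
        rw [ENNReal.ofReal_mul' measureReal_nonneg, measureReal_def,
          ENNReal.ofReal_toReal (measure_ne_top _ _)]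

/-- `‖I^α L‖_{BMO₂([0,T))} ≤ (3√(2α)/T^α) (∫_0^T (T−t)^{2α−1} ‖L_t‖_{L_∞}² dt)^{1/2}`
for a càdlàg martingale `L` with `L_0 ≡ 0`.  The BMO₂-bound is expressed (after squaring,
which is equivalent in `ℝ≥0∞`) through its definition: for every `t ∈ [0,T)`, every stopping
time `σ : Ω → [0,t]` and every version `Z` of the left limit `(I^α L)_{σ−}` one has
`E[|I_t^α L − Z|² | F_σ] ≤ c²` a.s., i.e. `∫_A |I_t^α L − Z|² dμ ≤ c² μ(A)` for all
`A ∈ F_σ`, with `c` the right-hand side above. -/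
theorem rl_BMO_bound
    {Ω : Type*} {mΩ : MeasurableSpace Ω} {μ : Measure Ω} [IsProbabilityMeasure μ]
    (ℱ : Filtration ℝ mΩ) (T : ℝ) (hT : 0 < T)
    (hComplete : ∀ s : ℝ, ∀ A : Set Ω, μ A = 0 → MeasurableSet[ℱ s] A)
    (hRight : ∀ s : ℝ, (ℱ s : MeasurableSpace Ω) = ⨅ u ∈ Set.Ioi s, (ℱ u : MeasurableSpace Ω))
    (α : ℝ) (hα : 0 < α)
    (L : ℝ → Ω → ℝ)
    (hL0 : ∀ ω, L 0 ω = 0)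
    (hCadlag : ∀ ω, CadlagOn (fun s => L s ω) T)
    (hAdapted : ∀ t ∈ Set.Ico (0:ℝ) T, StronglyMeasurable[ℱ t] (L t))
    (hInt : ∀ t ∈ Set.Ico (0:ℝ) T, Integrable (L t) μ)
    (hMart : ∀ s t : ℝ, s ∈ Set.Ico (0:ℝ) T → t ∈ Set.Ico (0:ℝ) T → s ≤ t →
      μ[L t | ℱ s] =ᵐ[μ] L s) :
    ∀ t ∈ Set.Ico (0:ℝ) T, ∀ σ : Ω → ℝ, ∀ hσ : IsStoppingTime ℱ (fun ω => (σ ω : WithTop ℝ)),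
      (∀ ω, σ ω ∈ Set.Icc 0 t) →
      ∀ Z : Ω → ℝ,
        (∀ ω, (σ ω = 0 → Z ω = rl T α (fun s => L s ω) 0) ∧
          (0 < σ ω → Filter.Tendsto (fun s => rl T α (fun r => L r ω) s)
            (nhdsWithin (σ ω) (Set.Iio (σ ω))) (nhds (Z ω)))) →
      ∀ A : Set Ω, MeasurableSet[hσ.measurableSpace] A →
        (∫⁻ ω in A, ENNReal.ofReal ((rl T α (fun s => L s ω) t - Z ω) ^ 2) ∂μ)
          ≤ (ENNReal.ofReal ((3 * Real.sqrt (2 * α) / T ^ α) ^ 2) *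
              ∫⁻ u in Set.Ioo (0:ℝ) T,
                ENNReal.ofReal ((T - u) ^ (2 * α - 1)) * (eLpNorm (L u) ⊤ μ) ^ 2) * μ A := by
  intro t ht σ hσ hσt Z hZ A hA
  have hAm : MeasurableSet A := hσ.measurableSpace_le A hA
  set J := ∫⁻ u in Set.Ioo (0:ℝ) T,
                ENNReal.ofReal ((T - u) ^ (2 * α - 1)) * (eLpNorm (L u) ⊤ μ) ^ 2 with hJdef
  by_cases hA0 : μ A = 0
  · rw [Measure.restrict_eq_zero.2 hA0]; simp
  have hTα : 0 < T ^ α := Real.rpow_pos_of_pos hT _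
  by_cases hJ : J = ⊤
  · rw [hJ, ENNReal.mul_top, ENNReal.top_mul hA0]
    · exact le_top
    · have : 0 < (3 * Real.sqrt (2 * α) / T ^ α) ^ 2 := by positivity
      exact (ENNReal.ofReal_pos.2 this).ne'
  have hrc : ∀ ω, ∀ s ∈ Ico 0 T, Tendsto (fun s => L s ω) (nhdsWithin s (Ici s)) (nhds (L s ω)) :=
    fun ω => (hCadlag ω).1
  have hmono : ∀ s ∈ Ico 0 T, ∀ r ∈ Ico 0 T, s ≤ r → eLpNorm (L s) ⊤ μ ≤ eLpNorm (L r) ⊤ μ := by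
    intro s hs r hr hsr
    rw [← eLpNorm_congr_ae (hMart s r hs hr hsr)]
    exact eLpNorm_condExp_le_eLpNorm _ le_top
  have hq1 : ∀ q ∈ Ico 0 T,
      ENNReal.ofReal ((T - q) ^ (2 * α) / (2 * α)) * (eLpNorm (L q) ⊤ μ) ^ 2 ≤ J := by
    intro q hq
    rw [← aux_lint T α q hα hq.2.le, ← lintegral_mul_const _ (by fun_prop)]
    calc _ ≤ ∫⁻ u in Ioo q T, ENNReal.ofReal ((T - u) ^ (2 * α - 1)) * (eLpNorm (L u) ⊤ μ) ^ 2 := by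
          apply setLIntegral_mono' measurableSet_Ioo
          intro u hu
          have := hmono q hq u ⟨hq.1.trans hu.1.le, hu.2⟩ hu.1.le
          gcongr
      _ ≤ J := lintegral_mono_set (Ioo_subset_Ioo_left hq.1)
  have hfin : ∀ q ∈ Ico 0 T, eLpNorm (L q) ⊤ μ ≠ ⊤ := by
    intro q hq h
    have h1 := hq1 q hq
    have h2 : 0 < (T - q) ^ (2 * α) / (2 * α) :=
      div_pos (Real.rpow_pos_of_pos (by linarith [hq.2]) _) (by linarith)
    rw [h, ENNReal.top_pow (by norm_num), ENNReal.mul_top (by simpa using h2)] at h1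
    exact hJ (top_le_iff.1 h1)
  have haL : ∀ q ∈ Ico 0 T, ∀ᵐ ω ∂μ, |L q ω| ≤ (eLpNorm (L q) ⊤ μ).toReal := by
    intro q hq
    have := hfin q hq
    rw [eLpNorm_exponent_top] at this ⊢
    filter_upwards [ae_le_eLpNormEssSup (f := L q) (μ := μ)] with ω h
    have h2 := ENNReal.toReal_mono this h
    simpa using h2
  have hK1 : ∀ q ∈ Ico 0 T,
      (T - q) ^ (2 * α) * (eLpNorm (L q) ⊤ μ).toReal ^ 2 ≤ 2 * α * J.toReal := by
    intro q hq
    have h1 := ENNReal.toReal_mono hJ (hq1 q hq)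
    have h2 : 0 < (T - q) ^ (2 * α) / (2 * α) :=
      div_pos (Real.rpow_pos_of_pos (by linarith [hq.2]) _) (by linarith)
    rw [ENNReal.toReal_mul, ENNReal.toReal_pow, ENNReal.toReal_ofReal h2.le] at h1
    rw [div_mul_eq_mul_div, div_le_iff₀ (by linarith)] at h1
    linarith
  set K := Real.sqrt (2 * α * J.toReal) with hK
  have hK0 : 0 ≤ K := Real.sqrt_nonneg _
  have hKsq : K ^ 2 = 2 * α * J.toReal := Real.sq_sqrt (by positivity)
  have hK2 : ∀ q ∈ Ico 0 T, ∀ᵐ ω ∂μ, (T - q) ^ α * |L q ω| ≤ K := by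
    intro q hq
    filter_upwards [haL q hq] with ω h
    have h0 : 0 ≤ (T - q) ^ α := Real.rpow_nonneg (by linarith [hq.2]) _
    apply Real.le_sqrt_of_sq_le
    refine le_trans ?_ (hK1 q hq)
    rw [mul_pow]
    have : (T - q) ^ (2 * α) = ((T - q) ^ α) ^ 2 := by
      rw [← Real.rpow_natCast, ← Real.rpow_mul (by linarith [hq.2])]; congr 1; push_cast; ring
    rw [this]
    gcongr
  have hgood : ∀ᵐ ω ∂μ, ∀ s ∈ Ico 0 T, (T - s) ^ α * |L s ω| ≤ K := by
    have : ∀ᵐ ω ∂μ, ∀ q : ℚ, (q : ℝ) ∈ Ico 0 T → (T - q) ^ α * |L q ω| ≤ K := by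
      rw [ae_all_iff]
      intro q
      by_cases hq : (q : ℝ) ∈ Ico 0 T
      · filter_upwards [hK2 q hq] with ω h _ using h
      · exact ae_of_all _ fun ω h => absurd h hq
    filter_upwards [this] with ω hω
    refine aux_rc (fun s => (T - s) ^ α * |L s ω|) T K ?_ hω
    intro s hs
    refine Tendsto.mul ?_ (hrc ω s hs).abs
    have : ContinuousAt (fun s => (T - s) ^ α) s := by
      apply ContinuousAt.rpow_const (by fun_prop); left; linarith [hs.2]
    exact this.tendsto.mono_left nhdsWithin_le_nhds
  have hTt : 0 < (T - t) ^ α := Real.rpow_pos_of_pos (by linarith [ht.2]) _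
  set M := K / (T - t) ^ α with hMdef
  have hM0 : 0 ≤ M := by positivity
  have hMb : ∀ ω, (∀ s ∈ Ico 0 T, (T - s) ^ α * |L s ω| ≤ K) → ∀ u ∈ Icc 0 t, |L u ω| ≤ M := by
    intro ω h u hu
    rw [hMdef, le_div_iff₀ hTt, mul_comm]
    refine le_trans ?_ (h u ⟨hu.1, hu.2.trans_lt ht.2⟩)
    have : (T - t) ^ α ≤ (T - u) ^ α :=
      Real.rpow_le_rpow (by linarith [ht.2]) (by linarith [hu.2]) hα.le
    gcongr
  have hσm : Measurable σ := by
    apply measurable_of_Iic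
    intro x
    have := ℱ.le x _ (hσ x)
    convert this using 1
    ext ω; simp
  have hA' : ∀ u, MeasurableSet[ℱ u] (A ∩ {ω | σ ω ≤ u}) := by
    intro u
    have := hA.2 u
    convert this using 2
    ext ω; simp
  have hproj : ∀ u, max 0 (min u t) ∈ Icc 0 t := fun u =>
    ⟨le_max_left _ _, max_le ht.1 (min_le_right _ _)⟩
  have hIcc : ∀ u ∈ Icc 0 t, u ∈ Ico 0 T := fun u hu => ⟨hu.1, hu.2.trans_lt ht.2⟩
  have hpe : ∀ u ∈ Icc 0 t, max 0 (min u t) = u := fun u hu => by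
    rw [min_eq_left hu.2, max_eq_right hu.1]
  set a : ℝ → ℝ := fun u => (eLpNorm (L (max 0 (min u t))) ⊤ μ).toReal with ha
  have hamono : Monotone a := by
    intro u v huv
    apply ENNReal.toReal_mono (hfin _ (hIcc _ (hproj v)))
    exact hmono _ (hIcc _ (hproj u)) _ (hIcc _ (hproj v))
      (max_le_max le_rfl (min_le_min huv le_rfl))
  have hCa : ∀ u, a u ≤ (eLpNorm (L t) ⊤ μ).toReal := fun u =>
    ENNReal.toReal_mono (hfin _ ht) (hmono _ (hIcc _ (hproj u)) _ ht (hproj u).2)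
  have hJr : ∫ u in Icc 0 t, (T - u) ^ (2 * α - 1) * a u ^ 2 ≤ J.toReal := by
    rw [integral_eq_lintegral_of_nonneg_ae]
    · apply ENNReal.toReal_mono hJ
      rw [← restrict_Ioc_eq_restrict_Icc]
      calc _ ≤ ∫⁻ u in Ioc 0 t,
            ENNReal.ofReal ((T - u) ^ (2 * α - 1)) * (eLpNorm (L u) ⊤ μ) ^ 2 := by
            apply setLIntegral_mono' measurableSet_Ioc
            intro u hu
            have hu' : u ∈ Icc 0 t := ⟨hu.1.le, hu.2⟩
            simp only [ha]
            rw [hpe u hu', ENNReal.ofReal_mul (Real.rpow_nonneg (by linarith [hu.2, ht.2]) _),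
              ENNReal.ofReal_pow ENNReal.toReal_nonneg, ENNReal.ofReal_toReal (hfin u (hIcc u hu'))]
        _ ≤ J := lintegral_mono_set (fun u hu => ⟨hu.1, hu.2.trans_lt ht.2⟩)
    · filter_upwards [ae_restrict_mem measurableSet_Icc] with u hu
      exact mul_nonneg (Real.rpow_nonneg (by linarith [hu.2, ht.2]) _) (sq_nonneg _)
    · apply Measurable.aestronglyMeasurable
      exact Measurable.mul (by fun_prop) (hamono.measurable.pow_const 2)
  have hI := aux_I (μ := μ) ℱ T α hα L hrc hAdapted hInt hMart t ht σ hσm hσt A hAm hA' M hM0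
    (hgood.mono hMb) a hamono (eLpNorm (L t) ⊤ μ).toReal (fun _ => ENNReal.toReal_nonneg) hCa
    (fun u hu => by simp only [ha]; rw [hpe u hu]; exact haL u (hIcc u hu)) J.toReal hJr
  have hpt : ∀ᵐ ω ∂μ, (rl T α (fun s => L s ω) t - Z ω) ^ 2 ≤
      3 / (T ^ α) ^ 2 * ((α * ∫ u in (σ ω)..t, (T - u) ^ (α - 1) * L u ω) ^ 2 + 2 * K ^ 2) := by
    filter_upwards [hgood] with ω hω
    have hint : IntegrableOn (fun u => (T - u) ^ (α - 1) * L u ω) (Icc 0 t) := by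
      have hc : ContinuousOn (fun u => (T - u) ^ (α - 1)) (Icc 0 t) := by
        apply ContinuousOn.rpow_const (by fun_prop)
        intro x hx; left; linarith [hx.2, ht.2]
      obtain ⟨C, hC⟩ := isCompact_Icc.exists_bound_of_continuousOn hc
      have hC0 : 0 ≤ C := (norm_nonneg _).trans (hC 0 ⟨le_rfl, ht.1⟩)
      have hLm : Measurable ((Ico 0 T).indicator (fun u => L u ω)) :=
        (aux_jm L T (fun s hs => ((hAdapted s hs).mono (ℱ.le s)).measurable) hrc).comp
          (measurable_prodMk_right (y := ω))
      have h1 : IntegrableOn (fun u => (T - u) ^ (α - 1) * (Ico 0 T).indicator (fun u => L u ω) u)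
          (Icc 0 t) := by
        refine Integrable.of_bound (C := C * M) ?_ ?_
        · apply Measurable.aestronglyMeasurable
          exact Measurable.mul (by fun_prop) hLm
        · filter_upwards [ae_restrict_mem measurableSet_Icc] with u hu
          rw [norm_mul, indicator_of_mem (hIcc u hu)]
          exact mul_le_mul (hC u hu) (hMb ω hω u hu) (norm_nonneg _) hC0
      refine h1.congr_fun (fun u hu => ?_) measurableSet_Icc
      simp only [indicator_of_mem (hIcc u hu)]
    have hsub : ∀ x y, x ∈ Icc 0 t → y ∈ Icc 0 t →
        IntervalIntegrable (fun u => (T - u) ^ (α - 1) * L u ω) volume x y := by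
      intro x y hx hy
      apply IntegrableOn.intervalIntegrable
      exact hint.mono_set (uIcc_subset_Icc hx hy)
    have h0t : (0:ℝ) ∈ Icc 0 t := ⟨le_rfl, ht.1⟩
    have htt : t ∈ Icc 0 t := ⟨ht.1, le_rfl⟩
    set P : ℝ → ℝ := fun s => ∫ u in (0:ℝ)..s, (T - u) ^ (α - 1) * L u ω with hP
    have hadd : P t = P (σ ω) + ∫ u in (σ ω)..t, (T - u) ^ (α - 1) * L u ω :=
      (intervalIntegral.integral_add_adjacent_intervals (hsub _ _ h0t (hσt ω))
        (hsub _ _ (hσt ω) htt)).symm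
    have hdivr : ∀ s ∈ Ico 0 T, ((T - s) / T) ^ α = (T - s) ^ α / T ^ α := fun s hs =>
      Real.div_rpow (by linarith [hs.2]) hT.le _
    have hYb : ∀ s ∈ Ico 0 T, |((T - s) / T) ^ α * L s ω| ≤ K / T ^ α := by
      intro s hs
      rw [hdivr s hs, abs_mul, abs_of_nonneg (div_nonneg (Real.rpow_nonneg (by linarith [hs.2]) _)
        hTα.le), div_mul_eq_mul_div]
      gcongr
      exact hω s hs
    have hW : |Z ω - (α / T ^ α) * P (σ ω)| ≤ K / T ^ α := by
      rcases (hσt ω).1.eq_or_lt with h | h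
      · rw [(hZ ω).1 h.symm, ← h]
        simp only [rl, hP]
        simp [hL0]
        positivity
      · have hlim := (hZ ω).2 h
        have hPc : Tendsto P (nhdsWithin (σ ω) (Iio (σ ω))) (nhds (P (σ ω))) := by
          have hc : ContinuousOn P (Icc 0 t) := by
            have := intervalIntegral.continuousOn_primitive_interval (a := 0) (b := t)
              (f := fun u => (T - u) ^ (α - 1) * L u ω) (μ := volume)
              (by rw [uIcc_of_le ht.1]; exact hint)
            rwa [uIcc_of_le ht.1] at this
          refine (hc (σ ω) (hσt ω)).mono_left ?_
          rw [← nhdsWithin_Ioo_eq_nhdsLT h]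
          exact nhdsWithin_mono _ fun x hx => ⟨hx.1.le, hx.2.le.trans (hσt ω).2⟩
        have h3 := (hlim.sub (hPc.const_mul (α / T ^ α))).abs
        refine le_of_tendsto h3 ?_
        filter_upwards [Ioo_mem_nhdsLT h] with s hs
        have hs' : s ∈ Ico 0 T := ⟨hs.1.le, hs.2.trans ((hσt ω).2.trans_lt ht.2)⟩
        have : rl T α (fun r => L r ω) s - α / T ^ α * P s = ((T - s) / T) ^ α * L s ω := by
          simp only [rl, hP]; ring
        rw [this]
        exact hYb s hs'
    set I := ∫ u in (σ ω)..t, (T - u) ^ (α - 1) * L u ω with hIdef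
    have hdec : rl T α (fun s => L s ω) t - Z ω = (α / T ^ α) * I + ((T - t) / T) ^ α * L t ω
        - (Z ω - (α / T ^ α) * P (σ ω)) := by
      have : rl T α (fun s => L s ω) t = (α / T ^ α) * P t + ((T - t) / T) ^ α * L t ω := rfl
      rw [this, hadd]; ring
    rw [hdec]
    have hy := sq_le_sq' (abs_le.1 (hYb t ht)).1 (abs_le.1 (hYb t ht)).2
    have hz := sq_le_sq' (abs_le.1 hW).1 (abs_le.1 hW).2
    have e : 3 / (T ^ α) ^ 2 * ((α * I) ^ 2 + 2 * K ^ 2)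
        = 3 * ((α / T ^ α * I) ^ 2 + 2 * (K / T ^ α) ^ 2) := by
      field_simp
    rw [e]
    generalize α / T ^ α * I = x at *
    generalize ((T - t) / T) ^ α * L t ω = y at *
    generalize Z ω - (α / T ^ α) * P (σ ω) = z at *
    nlinarith [sq_nonneg (x - y), sq_nonneg (x + z), sq_nonneg (y + z)]
  have hc0 : 0 ≤ 3 / (T ^ α) ^ 2 := by positivity
  calc _ ≤ ∫⁻ ω in A, ENNReal.ofReal (3 / (T ^ α) ^ 2) *
        (ENNReal.ofReal ((α * ∫ u in (σ ω)..t, (T - u) ^ (α - 1) * L u ω) ^ 2)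
          + ENNReal.ofReal (2 * K ^ 2)) ∂μ := by
        apply lintegral_mono_ae
        filter_upwards [ae_restrict_of_ae hpt] with ω h
        rw [← ENNReal.ofReal_add (sq_nonneg _) (by positivity), ← ENNReal.ofReal_mul hc0]
        exact ENNReal.ofReal_le_ofReal h
    _ = ENNReal.ofReal (3 / (T ^ α) ^ 2) *
        ((∫⁻ ω in A, ENNReal.ofReal ((α * ∫ u in (σ ω)..t, (T - u) ^ (α - 1) * L u ω) ^ 2) ∂μ)
          + ENNReal.ofReal (2 * K ^ 2) * μ A) := by
        rw [lintegral_const_mul' _ _ ENNReal.ofReal_ne_top, lintegral_add_right _ measurable_const,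
          setLIntegral_const]
    _ ≤ ENNReal.ofReal (3 / (T ^ α) ^ 2) *
        (ENNReal.ofReal (2 * α * J.toReal) * μ A + ENNReal.ofReal (2 * K ^ 2) * μ A) := by
        gcongr
    _ = _ := by
        have hJ' : J = ENNReal.ofReal J.toReal := (ENNReal.ofReal_toReal hJ).symm
        have hJ0 : 0 ≤ J.toReal := ENNReal.toReal_nonneg
        rw [← add_mul, ← ENNReal.ofReal_add (by positivity) (by positivity), ← mul_assoc,
          ← ENNReal.ofReal_mul hc0]
        conv_rhs => rw [hJ']
        rw [← ENNReal.ofReal_mul (sq_nonneg _), hKsq, div_pow, mul_pow,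
          Real.sq_sqrt (by positivity)]
        congr 2
        ring
end

section
/- Let T>0, ε>0, β∈(0,2], η∈[0,1], and let (X_s)_{s∈[0,T]} be a family of real random variables on a probability space with the following small-ball property: there exist c,r>0 such that for all −r ≤ a < b ≤ r and all s∈(0,T] one has P( s^{−1/β} X_s ∈ (a,b) ) ≥ (b−a)/c. Let ρ be a probability measure on ℝ with liminf_{d↓0} ρ([−d,d]∖{0})/d^ε > 0. Let f:ℝ→ℝ be right-continuous and non-decreasing with associated Lebesgue–Stieltjes measure μ_f satisfying liminf_{d↓0} μ_f([−d,d])/d^η > 0, and assume E|f(x+X_s)| < ∞ for all (s,x)∈[0,T]×ℝ. Define F(t,x) := E f(x + X_{T−t}) for (t,x)∈[0,T)×ℝ. Then inf_{t∈[0,T)} (T−t)^{(1−(ε+η))/β} · ∫_{ℝ∖{0}} (F(t,z) − F(t,0))/z ρ(dz) ∈ (0,∞], i.e. this infimum is strictly positive (the integrand is nonnegative since f is non-decreasing, so the integral is well defined in [0,∞]). -/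
open MeasureTheory Set ENNReal

lemma glb_aux {Ω : Type*} {mΩ : MeasurableSpace Ω} (P : Measure Ω) [IsProbabilityMeasure P]
    (Y : Ω → ℝ) (hY : Measurable Y) (f : StieltjesFunction ℝ)
    (hint : ∀ x : ℝ, Integrable (fun ω => f (x + Y ω)) P)
    (u v m B : ℝ) (huv : u < v) (hm : 0 < m) (hB : 0 < B) (I : Set ℝ) (hI : MeasurableSet I)
    (hBI : ENNReal.ofReal B ≤ f.measure I)
    (hP : ∀ y ∈ I, ENNReal.ofReal m ≤ P {ω | Y ω ∈ Set.Ioo (y - v) (y - u)}) :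
    m * B ≤ (∫ ω, f (v + Y ω) ∂P) - ∫ ω, f (u + Y ω) ∂P := by
  have h1 : ENNReal.ofReal ((∫ ω, f (v + Y ω) ∂P) - ∫ ω, f (u + Y ω) ∂P)
      = ∫⁻ ω, f.measure (Set.Ioc (u + Y ω) (v + Y ω)) ∂P := by
    rw [← integral_sub (hint v) (hint u), ofReal_integral_eq_lintegral_ofReal]
    · simp only [StieltjesFunction.measure_Ioc]
    · exact (hint v).sub (hint u)
    · refine Filter.Eventually.of_forall fun ω => ?_
      have := f.mono (show u + Y ω ≤ v + Y ω by linarith)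
      simpa using this
  have hS : MeasurableSet {p : Ω × ℝ | u + Y p.1 < p.2 ∧ p.2 ≤ v + Y p.1} := by
    apply MeasurableSet.inter
    · exact measurableSet_lt ((hY.comp measurable_fst).const_add u) measurable_snd
    · exact measurableSet_le measurable_snd ((hY.comp measurable_fst).const_add v)
  have h2 : ∫⁻ ω, f.measure (Set.Ioc (u + Y ω) (v + Y ω)) ∂P
      = ∫⁻ y, P {ω | u + Y ω < y ∧ y ≤ v + Y ω} ∂f.measure := by
    have e1 := Measure.prod_apply (μ := P) (ν := f.measure) hS
    have e2 := Measure.prod_apply_symm (μ := P) (ν := f.measure) hS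
    exact e1.symm.trans e2
  have h3 : ENNReal.ofReal (m * B) ≤ ∫⁻ y, P {ω | u + Y ω < y ∧ y ≤ v + Y ω} ∂f.measure := by
    calc ENNReal.ofReal (m * B) = ENNReal.ofReal m * ENNReal.ofReal B :=
          ENNReal.ofReal_mul hm.le
      _ ≤ ENNReal.ofReal m * f.measure I := by gcongr
      _ = ∫⁻ y in I, ENNReal.ofReal m ∂f.measure := by rw [setLIntegral_const]
      _ ≤ ∫⁻ y in I, P {ω | u + Y ω < y ∧ y ≤ v + Y ω} ∂f.measure := by
          refine setLIntegral_mono' hI fun y hy => (hP y hy).trans (measure_mono ?_)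
          rintro ω ⟨h1, h2⟩
          exact ⟨by linarith, by linarith⟩
      _ ≤ _ := setLIntegral_le_lintegral _ _
  rw [← h2, ← h1] at h3
  rcases ENNReal.ofReal_le_ofReal_iff'.1 h3 with h | h
  · exact h
  · exact absurd h (not_le.2 (mul_pos hm hB))

/-- Lower bound for the weighted difference operator applied to `F(t,x) = E f(x + X_{T−t})`:
under the small-ball conditions `X ∈ 𝓛(β)` and `ρ ∈ L(ε)` and the lower variation condition
on the non-decreasing right-continuous `f` (a Stieltjes function), one has
`inf_{t∈[0,T)} (T−t)^{(1−(ε+η))/β} ∫_{ℝ∖{0}} (F(t,z) − F(t,0))/z ρ(dz) > 0`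
(the integrand is nonnegative since `f` is non-decreasing, so the `lintegral` is the
integral in `[0,∞]`). -/
theorem gradient_lower_bound
    {Ω : Type*} {mΩ : MeasurableSpace Ω} (P : Measure Ω) [IsProbabilityMeasure P]
    (T : ℝ) (hT : 0 < T) (ε : ℝ) (hε : 0 < ε) (β : ℝ) (hβ : β ∈ Set.Ioc (0:ℝ) 2)
    (η : ℝ) (hη : η ∈ Set.Icc (0:ℝ) 1)
    (X : ℝ → Ω → ℝ) (hXm : ∀ s : ℝ, Measurable (X s))
    (hsmall : ∃ c r : ℝ, 0 < c ∧ 0 < r ∧ ∀ a b : ℝ, -r ≤ a → a < b → b ≤ r →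
      ∀ s ∈ Set.Ioc (0:ℝ) T,
        ENNReal.ofReal ((b - a) / c) ≤ P {ω | s ^ (-(1:ℝ) / β) * X s ω ∈ Set.Ioo a b})
    (ρ : Measure ℝ) [IsProbabilityMeasure ρ]
    (hρ : ∃ δ d₀ : ℝ, 0 < δ ∧ 0 < d₀ ∧ ∀ d ∈ Set.Ioc (0:ℝ) d₀,
      ENNReal.ofReal (δ * d ^ ε) ≤ ρ (Set.Icc (-d) d \ {0}))
    (f : StieltjesFunction ℝ)
    (hf : ∃ δ d₁ : ℝ, 0 < δ ∧ 0 < d₁ ∧ ∀ d ∈ Set.Ioc (0:ℝ) d₁,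
      ENNReal.ofReal (δ * d ^ η) ≤ f.measure (Set.Icc (-d) d))
    (hfint : ∀ s ∈ Set.Icc (0:ℝ) T, ∀ x : ℝ, Integrable (fun ω => f (x + X s ω)) P)
    (F : ℝ → ℝ → ℝ) (hF : ∀ t x : ℝ, F t x = ∫ ω, f (x + X (T - t) ω) ∂P) :
    ∃ δ : ℝ, 0 < δ ∧ ∀ t ∈ Set.Ico (0:ℝ) T,
      ENNReal.ofReal δ ≤ ENNReal.ofReal ((T - t) ^ ((1 - (ε + η)) / β)) *
        ∫⁻ z in ({0}ᶜ : Set ℝ), ENNReal.ofReal ((F t z - F t 0) / z) ∂ρ := by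
  obtain ⟨c, r, hc, hr, hsm⟩ := hsmall
  obtain ⟨δ₁, d₀, hδ₁, hd₀, hρ⟩ := hρ
  obtain ⟨δ₂, d₁, hδ₂, hd₁, hf⟩ := hf
  have hβ0 : 0 < β := hβ.1
  have hS : 0 < T ^ (1 / β) := Real.rpow_pos_of_pos hT _
  obtain ⟨κ, hκ, hκr, hκ0, hκ1⟩ : ∃ κ : ℝ, 0 < κ ∧ 2 * κ ≤ r ∧ κ * T ^ (1 / β) ≤ d₀ ∧
      κ * T ^ (1 / β) ≤ d₁ := by
    refine ⟨min (r / 2) (min (d₀ / T ^ (1 / β)) (d₁ / T ^ (1 / β))), by positivity, ?_, ?_, ?_⟩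
    · linarith [min_le_left (r / 2) (min (d₀ / T ^ (1 / β)) (d₁ / T ^ (1 / β)))]
    · rw [← le_div_iff₀ hS]
      exact (min_le_right _ _).trans (min_le_left _ _)
    · rw [← le_div_iff₀ hS]
      exact (min_le_right _ _).trans (min_le_right _ _)
  refine ⟨δ₂ * κ ^ η / c * (δ₁ * κ ^ ε), by positivity, fun t ht => ?_⟩
  have hs : 0 < T - t := by linarith [ht.2]
  have hsT : T - t ≤ T := by linarith [ht.1]
  set s := T - t with hsdef
  set σ := s ^ (1 / β) with hσdef
  have hσ : 0 < σ := Real.rpow_pos_of_pos hs _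
  have hσT : σ ≤ T ^ (1 / β) := Real.rpow_le_rpow hs.le hsT (by positivity)
  have hσinv : s ^ (-(1:ℝ) / β) = σ⁻¹ := by
    rw [hσdef, ← Real.rpow_neg hs.le, neg_div]
  set d := κ * σ with hd
  have hdpos : 0 < d := by positivity
  have hdd₀ : d ≤ d₀ := le_trans (by rw [hd]; gcongr) hκ0
  have hdd₁ : d ≤ d₁ := le_trans (by rw [hd]; gcongr) hκ1
  have hρd := hρ d ⟨hdpos, hdd₀⟩
  have hfd := hf d ⟨hdpos, hdd₁⟩
  have hB : 0 < δ₂ * d ^ η := by positivity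
  have key : ∀ u v : ℝ, u < v → -d ≤ u → v ≤ d → v - u ≤ d →
      (v - u) / (c * σ) * (δ₂ * d ^ η) ≤ F t v - F t u := by
    intro u v huv hu hv _
    rw [hF, hF]
    refine glb_aux P (X s) (hXm s) f (hfint s ⟨hs.le, hsT⟩) u v _ _ huv
      (div_pos (by linarith) (by positivity)) hB _ measurableSet_Icc hfd ?_
    intro y hy
    have h := hsm ((y - v) / σ) ((y - u) / σ) ?_ ?_ ?_ s ⟨hs, hsT⟩
    · have e : ((y - u) / σ - (y - v) / σ) / c = (v - u) / (c * σ) := by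
        field_simp; ring
      rw [e] at h
      refine h.trans (measure_mono ?_)
      rintro ω ⟨h1, h2⟩
      rw [hσinv, inv_mul_eq_div] at h1 h2
      exact ⟨(div_lt_div_iff_of_pos_right hσ).1 h1, (div_lt_div_iff_of_pos_right hσ).1 h2⟩
    · rw [le_div_iff₀ hσ]
      nlinarith [hy.1]
    · exact (div_lt_div_iff_of_pos_right hσ).2 (by linarith)
    · rw [div_le_iff₀ hσ]
      nlinarith [hy.2]
  have hK : ∀ z ∈ Set.Icc (-d) d \ {0},
      ENNReal.ofReal (δ₂ * d ^ η / (c * σ)) ≤ ENNReal.ofReal ((F t z - F t 0) / z) := by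
    rintro z ⟨⟨hz1, hz2⟩, hz0⟩
    apply ENNReal.ofReal_le_ofReal
    rcases lt_or_gt_of_ne (show z ≠ 0 from hz0) with hz | hz
    · have h := key z 0 hz hz1 hdpos.le (by linarith)
      rw [le_div_iff_of_neg hz]
      have e : (0 - z) / (c * σ) * (δ₂ * d ^ η) = - (δ₂ * d ^ η / (c * σ) * z) := by ring
      linarith
    · have h := key 0 z hz (by linarith) hz2 (by linarith)
      rw [le_div_iff₀ hz]
      have e : (z - 0) / (c * σ) * (δ₂ * d ^ η) = (δ₂ * d ^ η / (c * σ) * z) := by ring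
      linarith
  have hmeas : MeasurableSet (Set.Icc (-d) d \ {0}) :=
    measurableSet_Icc.diff (measurableSet_singleton _)
  have hint : ENNReal.ofReal (δ₂ * d ^ η / (c * σ)) * ENNReal.ofReal (δ₁ * d ^ ε) ≤
      ∫⁻ z in ({0}ᶜ : Set ℝ), ENNReal.ofReal ((F t z - F t 0) / z) ∂ρ := by
    calc _ ≤ ENNReal.ofReal (δ₂ * d ^ η / (c * σ)) * ρ (Set.Icc (-d) d \ {0}) := by gcongr
      _ = ∫⁻ z in Set.Icc (-d) d \ {0}, ENNReal.ofReal (δ₂ * d ^ η / (c * σ)) ∂ρ := by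
          rw [setLIntegral_const]
      _ ≤ ∫⁻ z in Set.Icc (-d) d \ {0}, ENNReal.ofReal ((F t z - F t 0) / z) ∂ρ :=
          setLIntegral_mono' hmeas hK
      _ ≤ _ := lintegral_mono_set (fun z hz => hz.2)
  refine le_trans (le_of_eq ?_) (mul_le_mul_right hint _)
  rw [← ENNReal.ofReal_mul (by positivity), ← ENNReal.ofReal_mul (by positivity)]
  congr 1
  have e1 : s ^ ((1 - (ε + η)) / β) = σ / (σ ^ ε * σ ^ η) := by
    rw [← Real.rpow_add hσ]
    conv_rhs => rw [← Real.rpow_one σ, ← Real.rpow_mul hσ.le, one_mul]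
    rw [← Real.rpow_sub hσ, hσdef, ← Real.rpow_mul hs.le]
    congr 1
    ring
  have hσε : 0 < σ ^ ε := Real.rpow_pos_of_pos hσ _
  have hση : 0 < σ ^ η := Real.rpow_pos_of_pos hσ _
  rw [e1, hd, Real.mul_rpow hκ.le hσ.le, Real.mul_rpow hκ.le hσ.le]
  field_simp
end
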